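/- For every edge e = {i,j} ∈ E, ∫ w_e / √(w_i·w_j) dμ_{v0,A}(w) = (a_e/2) · Γ(b_i)/Γ(b_i+1/2) · Γ(b_j)/Γ(b_j+1/2). -/

import Mathlib

open MeasureTheory Real Filter
open scoped ENNReal NNReal Classical BigOperators

noncomputable section

namespace ERRW

variable {V : Type*} [Fintype V] [DecidableEq V]

/-- Total weight at a vertex: sum of the edge weights over the edges incident to `i`. -/
def vw (G : SimpleGraph V) [DecidableRel G.Adj] (w : Sym2 V → ℝ) (i : V) : ℝ :=
  ∑ j ∈ G.neighborFinset i, w s(i, j)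

/-- Product of a vertex function over the two endpoints of an unordered pair. -/
def sprod (f : V → ℝ) : Sym2 V → ℝ :=
  Sym2.lift ⟨fun i j => f i * f j, fun i j => mul_comm _ _⟩

/-- Sum of a vertex function over the two endpoints of an unordered pair. -/
def ssum (f : V → ℝ) : Sym2 V → ℝ :=
  Sym2.lift ⟨fun i j => f i + f j, fun i j => add_comm _ _⟩

/-- Quenched transition probability `p_{ij}(w) = w_{ij}/w_i`. -/
def qstep (G : SimpleGraph V) [DecidableRel G.Adj] (w : Sym2 V → ℝ) (i j : V) : ℝ :=
  if G.Adj i j then w s(i, j) / vw G w i else 0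

/-- Stationary distribution `π_i(w) = w_i / Σ_v w_v` of the quenched chain. -/
def statDist (G : SimpleGraph V) [DecidableRel G.Adj] (w : Sym2 V → ℝ) (i : V) : ℝ :=
  vw G w i / ∑ v : V, vw G w v

/-- Spanning trees of `G`, as edge sets. -/
def spanningTrees (G : SimpleGraph V) [DecidableRel G.Adj] : Finset (Finset (Sym2 V)) :=
  G.edgeFinset.powerset.filter fun F =>
    (SimpleGraph.fromEdgeSet (F : Set (Sym2 V))).IsTree

/-- Spanning-tree polynomial `τ(w) = Σ_{T} Π_{e ∈ T} w_e`. -/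
def tau (G : SimpleGraph V) [DecidableRel G.Adj] (w : Sym2 V → ℝ) : ℝ :=
  ∑ F ∈ spanningTrees G, ∏ e ∈ F, w e

/-- Vertex parameter `b_v = (B_v + 1 - 𝟙(v = x))/2`. -/
def bwt (G : SimpleGraph V) [DecidableRel G.Adj] (x : V) (B : Sym2 V → ℝ) (v : V) : ℝ :=
  (vw G B v + 1 - if v = x then 1 else 0) / 2

/-- The normalizing constant `Z_{x,B}` of the magic formula. -/
def Znorm (G : SimpleGraph V) [DecidableRel G.Adj] (x : V) (B : Sym2 V → ℝ) : ℝ :=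
  ((∏ e ∈ G.edgeFinset, Real.Gamma (B e)) /
      ∏ v : V, Real.Gamma (bwt G x B v)) *
    Real.pi ^ (((Fintype.card V : ℝ) - 1) / 2) /
    2 ^ ((1 : ℝ) - (Fintype.card V : ℝ) + ∑ e ∈ G.edgeFinset, B e)

/-- The magic-formula density of `μ_{x,B}` with respect to `Π_{e ≠ e0} dw_e`. -/
def magicDensity (G : SimpleGraph V) [DecidableRel G.Adj] (x : V) (B : Sym2 V → ℝ)
    (w : Sym2 V → ℝ) : ℝ :=
  (Znorm G x B)⁻¹ * (vw G w x) ^ ((1 : ℝ) / 2) *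
      (∏ e ∈ G.edgeFinset, w e ^ (B e - 1)) /
      (∏ v : V, (vw G w v) ^ ((vw G B v + 1) / 2)) *
    Real.sqrt (tau G w)

/-- Coordinates indexed by the non-reference edges. -/
abbrev Epin (G : SimpleGraph V) [DecidableRel G.Adj] (e0 : Sym2 V) :=
  {e : Sym2 V // e ∈ G.edgeFinset ∧ e ≠ e0}

/-- Extension of non-reference edge coordinates to a pinned environment (`w_{e0} = 1`). -/
def pinExt (G : SimpleGraph V) [DecidableRel G.Adj] (e0 : Sym2 V)
    (u : Epin G e0 → ℝ) : Sym2 V → ℝ :=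
  fun e => if e = e0 then 1 else if h : e ∈ G.edgeFinset ∧ e ≠ e0 then u ⟨e, h⟩ else 0

/-- The mixing measure `μ_{x,B}` of the magic formula, as a measure on
environments pinned at the reference edge `e0`. -/
def mixing (G : SimpleGraph V) [DecidableRel G.Adj] (e0 : Sym2 V) (x : V) (B : Sym2 V → ℝ) :
    Measure (Sym2 V → ℝ) :=
  Measure.map (pinExt G e0)
    ((volume : Measure (Epin G e0 → ℝ)).withDensity fun u =>
      ENNReal.ofReal
        (if ∀ e ∈ G.edgeFinset, 0 < pinExt G e0 u e then
          magicDensity G x B (pinExt G e0 u) else 0))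

/-- Kullback–Leibler divergence (natural logarithm), `+∞` if `P` is not
absolutely continuous with respect to `Q`. -/
def KL {Ω : Type*} [MeasurableSpace Ω] (P Q : Measure Ω) : EReal :=
  if P ≪ Q then ((∫ x, Real.log (P.rnDeriv Q x).toReal ∂P : ℝ) : EReal) else ⊤

/-- Edge local time (current edge weight) at time `t` along a path. -/
def localTime (a : Sym2 V → ℝ) (x : ℕ → V) (t : ℕ) (e : Sym2 V) : ℝ :=
  a e + ((Finset.range t).filter fun k => s(x k, x (k + 1)) = e).card

/-- One-step ERRW conditional probability at time `t` given the past of the path. -/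
def errwStep (G : SimpleGraph V) [DecidableRel G.Adj] (a : Sym2 V → ℝ) (x : ℕ → V)
    (t : ℕ) : ℝ :=
  if G.Adj (x t) (x (t + 1)) then
    localTime a x t s(x t, x (t + 1)) /
      ∑ u ∈ G.neighborFinset (x t), localTime a x t s(x t, u)
  else 0

/-- Extension of a finite path to ℕ (junk value `v0` beyond time `T`). -/
def extendPath {T : ℕ} (v0 : V) (x : Fin (T + 1) → V) : ℕ → V :=
  fun t => if h : t < T + 1 then x ⟨t, h⟩ else v0

/-- ERRW trajectory probability of a length-`T` path (the trajectory law mass function). -/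
def errwProb (G : SimpleGraph V) [DecidableRel G.Adj] (v0 : V) (a : Sym2 V → ℝ) (T : ℕ)
    (x : Fin (T + 1) → V) : ℝ :=
  if x 0 = v0 then ∏ t ∈ Finset.range T, errwStep G a (extendPath v0 x) t else 0

/-- Undirected traversal count `N_e` of an edge along a finite path. -/
def edgeCount {T : ℕ} (v0 : V) (x : Fin (T + 1) → V) (e : Sym2 V) : ℕ :=
  ((Finset.range T).filter fun k =>
    s(extendPath v0 x k, extendPath v0 x (k + 1)) = e).card

/-- Quenched path probability of a length-`T` path started at `v0`. -/
def quenchedProb (G : SimpleGraph V) [DecidableRel G.Adj] (v0 : V) (w : Sym2 V → ℝ) (T : ℕ)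
    (x : Fin (T + 1) → V) : ℝ :=
  if x 0 = v0 then
    ∏ t ∈ Finset.range T, qstep G w (extendPath v0 x t) (extendPath v0 x (t + 1))
  else 0

/-- The measure on a finite type determined by a mass function. -/
def discreteMeasure {Ω : Type*} [Fintype Ω] [MeasurableSpace Ω] (p : Ω → ℝ) : Measure Ω :=
  ∑ x : Ω, ENNReal.ofReal (p x) • Measure.dirac x

/-- Digamma function `Ψ = (log Γ)'`. -/
def digamma (x : ℝ) : ℝ := deriv (fun y => Real.log (Real.Gamma y)) x

/-- Trigamma function `Ψ₁ = Ψ'`. -/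
def trigamma (x : ℝ) : ℝ := deriv digamma x

/-- `Λ(p,q) = log Γ(q) − log Γ(p) − (q−p)·Ψ(p)`. -/
def Lam (p q : ℝ) : ℝ :=
  Real.log (Real.Gamma q) - Real.log (Real.Gamma p) - (q - p) * digamma p

lemma deriv_sub_div_sqrt (z : ℝ) {y : ℝ} (hy : 0 < y) :
    HasDerivAt (fun y => √y - z / √y) ((1 + z / y) / (2 * √y)) y := by
  have h := (hasDerivAt_sqrt hy.ne')
  have h2 := h.sub ((hasDerivAt_const y z).div h (sqrt_pos.2 hy).ne')
  refine h2.congr_deriv ?_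
  have : √y ^ 2 = y := sq_sqrt hy.le
  have h3 := (sqrt_pos.2 hy).ne'
  rw [show z / y = z / (√y)^2 by rw [this]]
  field_simp
  ring

lemma image_sub_div_sqrt {z : ℝ} (hz : 0 < z) :
    (fun y => √y - z / √y) '' Set.Ioi 0 = Set.univ := by
  refine Set.eq_univ_of_forall fun x => ?_
  have hs : |x| < √(x ^ 2 + 4 * z) := by
    rw [← sqrt_sq_eq_abs]; exact sqrt_lt_sqrt (sq_nonneg x) (by linarith)
  have hp : 0 < x + √(x ^ 2 + 4 * z) := by linarith [neg_abs_le x]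
  have hsq : √(x ^ 2 + 4 * z) ^ 2 = x ^ 2 + 4 * z := sq_sqrt (by positivity)
  refine ⟨((x + √(x ^ 2 + 4 * z)) / 2) ^ 2, by simp only [Set.mem_Ioi]; positivity, ?_⟩
  simp only
  rw [sqrt_sq (by positivity)]
  field_simp
  linarith

lemma injOn_sub_div_sqrt {z : ℝ} (hz : 0 ≤ z) :
    Set.InjOn (fun y => √y - z / √y) (Set.Ioi 0) := by
  refine StrictMonoOn.injOn fun x hx y hy hxy => ?_
  have h1 : √x < √y := sqrt_lt_sqrt (le_of_lt hx) hxy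
  have h2 : z / √y ≤ z / √x := div_le_div_of_nonneg_left hz (sqrt_pos.2 hx) h1.le
  linarith

lemma lintegral_exp_neg_sq : ∫⁻ x : ℝ, ENNReal.ofReal (exp (-x ^ 2)) = ENNReal.ofReal √π := by
  have h := integral_gaussian 1
  have hi := integrable_exp_neg_mul_sq (b := 1) one_pos
  simp only [neg_mul, one_mul, div_one] at h hi
  rw [← h, ofReal_integral_eq_lintegral_ofReal hi (ae_of_all _ fun x => (exp_pos _).le)]

/-- Inverse Gaussian normalization. -/
lemma lintegral_invGaussian {z : ℝ} (hz : 0 ≤ z) :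
    ∫⁻ y in Set.Ioi (0 : ℝ), ENNReal.ofReal (exp (-(y + z ^ 2 / y)) / √y)
      = ENNReal.ofReal (√π * exp (-(2 * z))) := by
  rcases hz.eq_or_lt with rfl | hz
  · have h := Real.Gamma_eq_integral (s := 1 / 2) (by norm_num)
    have hi := Real.GammaIntegral_convergent (s := 1 / 2) (by norm_num)
    rw [Real.Gamma_one_half_eq] at h
    simp only [mul_zero, neg_zero, exp_zero, mul_one]
    rw [h, ofReal_integral_eq_lintegral_ofReal hi]
    · refine setLIntegral_congr_fun measurableSet_Ioi fun y hy => ?_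
      congr 1
      rw [show (1 / 2 - 1 : ℝ) = -(1 / 2) by norm_num, rpow_neg (le_of_lt hy), ← sqrt_eq_rpow]
      simp [div_eq_mul_inv]
    · filter_upwards [self_mem_ae_restrict measurableSet_Ioi] with y hy
      exact mul_nonneg (exp_pos _).le (rpow_nonneg (le_of_lt hy) _)
  have key : ∀ y ∈ Set.Ioi (0:ℝ), exp (-(√y - z / √y) ^ 2) = exp (2 * z) * exp (-(y + z ^ 2 / y)) := by
    intro y hy
    have hy : 0 < y := hy
    rw [← exp_add]
    congr 1
    have h3 := (sqrt_pos.2 hy).ne'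
    have : √y ^ 2 = y := sq_sqrt hy.le
    rw [show z ^ 2 / y = z ^ 2 / (√y)^2 by rw [this]]
    nth_rewrite 3 [← this]
    field_simp
    ring
  have h1 := lintegral_image_eq_lintegral_abs_deriv_mul measurableSet_Ioi
    (fun y hy => (deriv_sub_div_sqrt z hy).hasDerivWithinAt) (injOn_sub_div_sqrt hz.le)
    (fun x => ENNReal.ofReal (exp (-x ^ 2)))
  rw [image_sub_div_sqrt hz, Measure.restrict_univ, lintegral_exp_neg_sq] at h1
  set I := ∫⁻ y in Set.Ioi (0 : ℝ), ENNReal.ofReal (exp (-(y + z ^ 2 / y)) / √y) with hI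
  set f : ℝ → ℝ≥0∞ := fun y => ENNReal.ofReal (exp (-(y + z ^ 2 / y)) / √y) with hf
  have h2 : I = ∫⁻ y in Set.Ioi (0 : ℝ), ENNReal.ofReal (z / y * (exp (-(y + z ^ 2 / y)) / √y)) := by
    have himg : (fun y => z ^ 2 / y) '' Set.Ioi 0 = Set.Ioi (0 : ℝ) := by
      ext y
      simp only [Set.mem_image, Set.mem_Ioi]
      constructor
      · rintro ⟨x, hx, rfl⟩; positivity
      · intro hy; exact ⟨z ^ 2 / y, by positivity, by field_simp⟩
    have hinj : Set.InjOn (fun y => z ^ 2 / y) (Set.Ioi (0 : ℝ)) := by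
      intro x hx y hy h
      have hx : 0 < x := hx
      have hy : 0 < y := hy
      simp only at h
      field_simp at h
      exact h.symm
    have hd : ∀ y ∈ Set.Ioi (0 : ℝ),
        HasDerivWithinAt (fun y => z ^ 2 / y) (-(z ^ 2) / y ^ 2) (Set.Ioi 0) y := by
      intro y hy
      have hy : 0 < y := hy
      refine (((hasDerivAt_const y (z ^ 2)).div (hasDerivAt_id y) hy.ne').congr_deriv ?_).hasDerivWithinAt
      simp
    have h := lintegral_image_eq_lintegral_abs_deriv_mul measurableSet_Ioi hd hinj f
    rw [himg] at h
    rw [hI, h]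
    refine setLIntegral_congr_fun measurableSet_Ioi fun y hy => ?_
    have hy : 0 < y := hy
    simp only [hf]
    rw [← ENNReal.ofReal_mul (abs_nonneg _)]
    congr 1
    rw [sqrt_div (sq_nonneg z), sqrt_sq hz.le, abs_div, abs_neg,
        abs_of_pos (by positivity : 0 < z^2),
      abs_of_pos (by positivity : 0 < y^2), show z ^ 2 / y + z ^ 2 / (z ^ 2 / y) = y + z ^ 2 / y by
        field_simp; ring]
    have h3 := (sqrt_pos.2 hy).ne'
    have h4 : √y * √y = y := mul_self_sqrt hy.le
    field_simp
    rw [sq, h4]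
  have h3 : ENNReal.ofReal √π = ENNReal.ofReal (exp (2 * z) / 2) * (I + I) := by
    nth_rewrite 2 [h2]
    rw [h1, hI, ← lintegral_add_left (by fun_prop), ← lintegral_const_mul _ (by fun_prop)]
    refine setLIntegral_congr_fun measurableSet_Ioi fun y hy => ?_
    have hy' : 0 < y := hy
    have := sqrt_pos.2 hy'
    rw [key y hy, ← ENNReal.ofReal_mul (abs_nonneg _), ← ENNReal.ofReal_add (by positivity) (by positivity),
      ← ENNReal.ofReal_mul (by positivity), abs_of_pos (by positivity)]
    congr 1
    field_simp
  have h4 : I = ENNReal.ofReal (exp (-(2 * z))) * (ENNReal.ofReal (exp (2 * z) / 2) * (I + I)) := by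
    rw [← mul_assoc, ← ENNReal.ofReal_mul (exp_pos _).le, mul_div_assoc', ← exp_add, ← two_mul I,
      ← mul_assoc, show (2:ℝ≥0∞) = ENNReal.ofReal 2 by simp, ← ENNReal.ofReal_mul (by positivity)]
    simp
  rw [h4, ← h3, ← ENNReal.ofReal_mul (exp_pos _).le, mul_comm]

open Matrix in
lemma nonneg_of_posDef_mulVec_nonneg {U : Type*} [Fintype U] {H : Matrix U U ℝ}
    (hH : H.PosDef) (hoff : ∀ i j, i ≠ j → H i j ≤ 0) {s : U → ℝ} (hs : 0 ≤ H *ᵥ s) : 0 ≤ s := by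
  set n : U → ℝ := fun i => max (-s i) 0 with hn
  set p : U → ℝ := fun i => max (s i) 0 with hp
  have hsp : s = p - n := by
    ext i; simp only [hn, hp, Pi.sub_apply]
    rcases le_total (s i) 0 with h | h <;> simp [h]
  have hn0 : 0 ≤ n := fun i => le_max_right _ _
  have h1 : 0 ≤ n ⬝ᵥ H *ᵥ s := Finset.sum_nonneg fun i _ => mul_nonneg (hn0 i) (hs i)
  have h2 : n ⬝ᵥ H *ᵥ p ≤ 0 := by
    simp only [dotProduct, mulVec, Finset.mul_sum]
    refine Finset.sum_nonpos fun i _ => Finset.sum_nonpos fun j _ => ?_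
    by_cases hij : i = j
    · subst hij
      rcases le_total (s i) 0 with h | h <;> simp [hn, hp, h]
    · exact mul_nonpos_of_nonneg_of_nonpos (hn0 i)
        (mul_nonpos_of_nonpos_of_nonneg (hoff i j hij) (le_max_right _ _))
  have h3 : n = 0 := by
    by_contra h
    have := hH.dotProduct_mulVec_pos h
    rw [star_trivial] at this
    rw [hsp, mulVec_sub, dotProduct_sub] at h1
    linarith
  intro i
  have := congrFun h3 i
  simp only [hn, Pi.zero_apply, max_eq_right_iff] at this
  simpa using this

open Matrix in
lemma posDef_iff_posSemidef_det_ne_zero {U : Type*} [Fintype U] [DecidableEq U] {H : Matrix U U ℝ} :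
    H.PosDef ↔ H.PosSemidef ∧ H.det ≠ 0 := by
  refine ⟨fun h => ⟨h.posSemidef, h.det_pos.ne'⟩, fun ⟨h, hd⟩ => ?_⟩
  exact h.posDef_iff_isUnit.2 ((isUnit_iff_isUnit_det _).2 hd.isUnit)

section Bordered
open Matrix
variable {U : Type*} [Fintype U] [DecidableEq U]

/-- The symmetric matrix obtained from `D` by adding one row and column. -/
def bordered (a : ℝ) (ω : U → ℝ) (D : Matrix U U ℝ) : Matrix (Unit ⊕ U) (Unit ⊕ U) ℝ :=
  fromBlocks (of fun _ _ => a) (of fun _ j => -ω j) (of fun i _ => -ω i) D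

lemma det_bordered (a : ℝ) (ω : U → ℝ) {D : Matrix U U ℝ} (hD : IsUnit D.det) :
    (bordered a ω D).det = D.det * (a - ω ⬝ᵥ D⁻¹ *ᵥ ω) := by
  have := D.invertibleOfIsUnitDet hD
  rw [bordered, det_fromBlocks₂₂, invOf_eq_nonsing_inv, det_unique (n := Unit)]
  congr 1
  simp [mul_apply, dotProduct, mulVec, Finset.mul_sum, Finset.sum_mul]
  rw [Finset.sum_comm]
  simp [mul_assoc]

lemma posDef_bordered_iff (a : ℝ) (ω : U → ℝ) (D : Matrix U U ℝ) :
    (bordered a ω D).PosDef ↔ D.PosDef ∧ 0 < a - ω ⬝ᵥ D⁻¹ *ᵥ ω := by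
  constructor
  · intro h
    have hD : D.PosDef := h.submatrix (e := Sum.inr) Sum.inr_injective
    refine ⟨hD, ?_⟩
    have h1 := h.det_pos
    rw [det_bordered a ω hD.det_pos.ne'.isUnit] at h1
    exact pos_of_mul_pos_right h1 hD.det_pos.le
  · rintro ⟨hD, h⟩
    have := D.invertibleOfIsUnitDet hD.det_pos.ne'.isUnit
    rw [posDef_iff_posSemidef_det_ne_zero]
    constructor
    · have := (PosDef.fromBlocks₂₂ (of fun _ _ => a) (of fun (_ : Unit) j => -ω j) hD)
      have hc : (of fun (_ : Unit) j => -ω j)ᴴ = (of fun i (_ : Unit) => -ω i) := by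
        ext i j; simp
      rw [hc] at this
      rw [bordered, this]
      have h2 : (of fun (_ : Unit) (_ : Unit) => a) - (of fun (_ : Unit) j => -ω j) * D⁻¹ *
          (of fun i (_ : Unit) => -ω i) = diagonal fun _ => a - ω ⬝ᵥ D⁻¹ *ᵥ ω := by
        ext i j
        simp [mul_apply, dotProduct, mulVec, Finset.mul_sum, Finset.sum_mul]
        rw [Finset.sum_comm]
        simp [mul_assoc]
      rw [h2]
      exact PosSemidef.diagonal fun _ => h.le
    · rw [det_bordered a ω hD.det_pos.ne'.isUnit]
      exact (mul_pos hD.det_pos h).ne'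

/-- The integrand of the Sabot–Tarrès–Zeng integral, as a function of the matrix. -/
def stzDensity (H : Matrix U U ℝ) (η : U → ℝ) : ℝ :=
  exp (-(1 ⬝ᵥ H *ᵥ 1 + η ⬝ᵥ H⁻¹ *ᵥ η - 2 * (1 ⬝ᵥ η))) / √H.det

lemma stzDensity_bordered (a h : ℝ) (ω η : U → ℝ) {D : Matrix U U ℝ} (hD : D.PosDef)
    {y : ℝ} (hy : y = a - ω ⬝ᵥ D⁻¹ *ᵥ ω) (hy0 : 0 < y)
    {z : ℝ} (hz : z = h + ω ⬝ᵥ D⁻¹ *ᵥ η) :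
    stzDensity (bordered a ω D) (Sum.elim (fun _ => h) η) =
      exp (2 * z) * stzDensity D (η + ω) * (exp (-(y + z ^ 2 / y)) / √y) := by
  have hdu : IsUnit D.det := hD.det_pos.ne'.isUnit
  have hM : IsUnit (bordered a ω D).det := by
    rw [det_bordered a ω hdu, ← hy]; exact (mul_pos hD.det_pos hy0).ne'.isUnit
  have hsymm : η ⬝ᵥ D⁻¹ *ᵥ ω = ω ⬝ᵥ D⁻¹ *ᵥ η := by
    have : (D⁻¹)ᵀ = D⁻¹ := by simpa using hD.inv.isHermitian.eq
    rw [dotProduct_mulVec, ← mulVec_transpose, this, dotProduct_comm]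
  have hs : (bordered a ω D)⁻¹ *ᵥ (Sum.elim (fun _ => h) η) =
      Sum.elim (fun _ : Unit => z / y) (D⁻¹ *ᵥ (η + (z / y) • ω)) := by
    have : bordered a ω D *ᵥ (Sum.elim (fun _ : Unit => z / y) (D⁻¹ *ᵥ (η + (z / y) • ω))) =
        Sum.elim (fun _ => h) η := by
      rw [bordered, fromBlocks_mulVec]
      simp only [Sum.elim_comp_inl, Sum.elim_comp_inr, mulVec_mulVec, mul_nonsing_inv D hdu,
          one_mulVec]
      congr 1
      · ext _
        have : (of fun (_ : Unit) j => -ω j) *ᵥ (D⁻¹ *ᵥ (η + (z / y) • ω)) = fun _ =>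
            -(ω ⬝ᵥ D⁻¹ *ᵥ (η + (z / y) • ω)) := by
          ext _; simp [mulVec, dotProduct]
        rw [← mulVec_mulVec, Pi.add_apply, this, mulVec_add, mulVec_smul, dotProduct_add,
            dotProduct_smul]
        simp [mulVec, dotProduct] at hy hz ⊢
        field_simp
        rw [hz]
        linear_combination (h + ∑ x, ω x * ∑ x_1, D⁻¹ x x_1 * η x_1) * (-hy)
      · ext i
        simp [mulVec, dotProduct]
        ring
    rw [← this, mulVec_mulVec, nonsing_inv_mul _ hM, one_mulVec]
  have h1 : (1 : Unit ⊕ U → ℝ) ⬝ᵥ bordered a ω D *ᵥ 1 = a - 2 * (1 ⬝ᵥ ω) + 1 ⬝ᵥ D *ᵥ 1 := by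
    simp [bordered, dotProduct, mulVec, Finset.sum_add_distrib]
    ring
  have h2 : Sum.elim (fun _ : Unit => h) η ⬝ᵥ
      Sum.elim (fun _ : Unit => z / y) (D⁻¹ *ᵥ (η + (z / y) • ω)) =
      h * (z / y) + (η ⬝ᵥ D⁻¹ *ᵥ η + (z / y) * (η ⬝ᵥ D⁻¹ *ᵥ ω)) := by
    rw [sumElim_dotProduct_sumElim, mulVec_add, mulVec_smul, dotProduct_add, dotProduct_smul]
    simp [dotProduct]
  have h3 : (1 : Unit ⊕ U → ℝ) ⬝ᵥ Sum.elim (fun _ : Unit => h) η = h + 1 ⬝ᵥ η := by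
    simp [dotProduct]
  have h4 : (η + ω) ⬝ᵥ D⁻¹ *ᵥ (η + ω) =
      η ⬝ᵥ D⁻¹ *ᵥ η + 2 * (ω ⬝ᵥ D⁻¹ *ᵥ η) + ω ⬝ᵥ D⁻¹ *ᵥ ω := by
    rw [mulVec_add, dotProduct_add, add_dotProduct, add_dotProduct, hsymm]; ring
  rw [stzDensity, stzDensity, hs, h1, h2, h3, h4, det_bordered a ω hdu, ← hy,
    sqrt_mul hD.det_pos.le, ← mul_div_assoc (exp (2 * z)), ← exp_add, div_mul_div_comm, ← exp_add,
    hsymm,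
    dotProduct_add]
  congr 2
  have hz' : ω ⬝ᵥ D⁻¹ *ᵥ η = z - h := by linarith
  have hy' : ω ⬝ᵥ D⁻¹ *ᵥ ω = a - y := by linarith
  rw [hz', hy']
  field_simp
  ring
end Bordered

lemma lintegral_pi_reindex {ι κ : Type*} [Fintype ι] [Fintype κ] (e : ι ≃ κ)
    (f : (κ → ℝ) → ℝ≥0∞) : ∫⁻ x, f x = ∫⁻ y : ι → ℝ, f (y ∘ e.symm) := by
  rw [(volume_measurePreserving_piCongrLeft (fun _ : κ => ℝ) e).lintegral_map_equiv f]
  refine lintegral_congr fun y => ?_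
  congr 1
  ext k
  obtain ⟨i, rfl⟩ := e.surjective k
  simp [MeasurableEquiv.coe_piCongrLeft, Equiv.piCongrLeft_apply_apply]

lemma lintegral_pi_unit_sum {ι : Type*} [Fintype ι] {f : (Unit ⊕ ι → ℝ) → ℝ≥0∞}
    (hf : Measurable f) :
    ∫⁻ x, f x = ∫⁻ y : ι → ℝ, ∫⁻ b : ℝ, f (Sum.elim (fun _ => b) y) := by
  rw [(volume_measurePreserving_sumPiEquivProdPi_symm
      (fun _ : Unit ⊕ ι => ℝ)).lintegral_map_equiv f,
    Measure.volume_eq_prod, lintegral_prod_symm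
      (fun p => f ((MeasurableEquiv.sumPiEquivProdPi fun _ : Unit ⊕ ι => ℝ).symm p))
      (hf.comp (MeasurableEquiv.measurable _)).aemeasurable]
  refine lintegral_congr fun y => ?_
  rw [(volume_preserving_funUnique Unit ℝ).symm.lintegral_map_equiv]
  refine lintegral_congr fun b => ?_
  congr 1

lemma lintegral_empty_pi {ι : Type*} [Fintype ι] [IsEmpty ι] (f : (ι → ℝ) → ℝ≥0∞) :
    ∫⁻ x, f x = f isEmptyElim := by
  rw [volume_pi, Measure.pi_of_empty _ isEmptyElim, lintegral_dirac]

section STZ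
open Matrix
variable {U : Type*} [Fintype U] [DecidableEq U]

lemma measurableSet_posDef {X : Type*} [TopologicalSpace X] [MeasurableSpace X] [BorelSpace X]
    {M : X → Matrix U U ℝ} (hM : Continuous M) (hs : ∀ x, (M x).IsHermitian) :
    MeasurableSet {x | (M x).PosDef} := by
  have : {x | (M x).PosDef} =
      (⋂ v : U → ℝ, {x | 0 ≤ v ⬝ᵥ M x *ᵥ v}) ∩ {x | (M x).det = 0}ᶜ := by
    ext x
    simp only [Set.mem_ofPred_eq, posDef_iff_posSemidef_det_ne_zero, Set.mem_inter_iff,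
      Set.mem_iInter, Set.mem_compl_iff, posSemidef_iff_dotProduct_mulVec, hs x, true_and,
      star_trivial]
  rw [this]
  refine MeasurableSet.inter (IsClosed.measurableSet ?_) (IsClosed.measurableSet ?_).compl
  · exact isClosed_iInter fun v => isClosed_le continuous_const (by fun_prop)
  · exact isClosed_eq hM.matrix_det continuous_const

lemma measurable_stzDensity {X : Type*} [TopologicalSpace X] [MeasurableSpace X] [BorelSpace X]
    {M : X → Matrix U U ℝ} (hM : Continuous M) (η : U → ℝ) :
    Measurable fun x => stzDensity (M x) η := by
  have h1 : Measurable fun x => (M x).det := hM.matrix_det.measurable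
  have h2 : Measurable fun x => (1 : U → ℝ) ⬝ᵥ M x *ᵥ 1 :=
    Continuous.measurable (by fun_prop)
  have h3 : Measurable fun x => η ⬝ᵥ (M x)⁻¹ *ᵥ η := by
    have : (fun x => η ⬝ᵥ (M x)⁻¹ *ᵥ η) = fun x => ((M x).det)⁻¹ * (η ⬝ᵥ (M x).adjugate *ᵥ η) := by
      ext x
      rw [inv_def, Ring.inverse_eq_inv', smul_mulVec, dotProduct_smul, smul_eq_mul]
    rw [this]
    have h4 := hM.matrix_adjugate
    exact h1.inv.mul (Continuous.measurable (by fun_prop))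
  unfold stzDensity
  fun_prop

/-- The total mass of the Sabot–Tarrès–Zeng measure with weight matrix `W` and boundary vector `η`. -/
def stzMass (W : Matrix U U ℝ) (η : U → ℝ) : ℝ≥0∞ :=
  ∫⁻ β : U → ℝ, if (diagonal β - W).PosDef then
    ENNReal.ofReal (stzDensity (diagonal β - W) η) else 0

lemma stzMass_reindex {U' : Type*} [Fintype U'] [DecidableEq U'] (e : U ≃ U')
    (W : Matrix U' U' ℝ) (η : U' → ℝ) :
    stzMass W η = stzMass (W.submatrix e e) (η ∘ e) := by
  rw [stzMass, lintegral_pi_reindex e, stzMass]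
  refine lintegral_congr fun β => ?_
  have h : diagonal (β ∘ e.symm) - W = (diagonal β - W.submatrix e e).submatrix e.symm e.symm := by
    ext i j
    simp [diagonal_apply]
  have h2 : (diagonal (β ∘ e.symm) - W).PosDef ↔ (diagonal β - W.submatrix e e).PosDef := by
    rw [h]
    refine ⟨fun hh => ?_, fun hh => hh.submatrix e.symm.injective⟩
    have := hh.submatrix (e := e) e.injective
    simpa using this
  have h3 : stzDensity (diagonal (β ∘ e.symm) - W) η = stzDensity (diagonal β - W.submatrix e e) (η ∘ e) := by
    rw [h, stzDensity, stzDensity, det_submatrix_equiv_self, inv_submatrix_equiv]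
    have h4 : ∀ (M : Matrix U U ℝ) (v : U' → ℝ),
        v ⬝ᵥ M.submatrix e.symm e.symm *ᵥ v = (v ∘ e) ⬝ᵥ M *ᵥ (v ∘ e) := by
      intro M v
      simp only [dotProduct, mulVec, submatrix_apply, Function.comp_apply]
      rw [← e.sum_comp]
      refine Finset.sum_congr rfl fun i _ => ?_
      rw [← e.sum_comp]
      simp
    rw [h4, h4]
    have h5 : (1 : U' → ℝ) ⬝ᵥ η = 1 ⬝ᵥ (η ∘ e) := by
      simp [dotProduct, e.sum_comp]
    rw [h5]
    rfl
  simp only [h2, h3]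

lemma stzMass_unit_sum (W : Matrix (Unit ⊕ U) (Unit ⊕ U) ℝ) (hW : W.IsSymm)
    (hoff : ∀ i j, i ≠ j → 0 ≤ W i j) (η : Unit ⊕ U → ℝ) (hη : 0 ≤ η) :
    stzMass W η = ENNReal.ofReal √π * stzMass W.toBlocks₂₂
      (η ∘ Sum.inr + fun j => W (Sum.inl ()) (Sum.inr j)) := by
  set ω : U → ℝ := fun j => W (Sum.inl ()) (Sum.inr j) with hω
  set c := W (Sum.inl ()) (Sum.inl ())
  have hcont : Continuous fun β : Unit ⊕ U → ℝ => diagonal β - W := by fun_prop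
  have hherm : ∀ β : Unit ⊕ U → ℝ, (diagonal β - W).IsHermitian := fun β => by
    rw [IsHermitian, conjTranspose_eq_transpose_of_trivial]
    exact (isSymm_diagonal β).sub hW
  have hcont' : Continuous fun β : U → ℝ => diagonal β - W.toBlocks₂₂ := by fun_prop
  have hherm' : ∀ β : U → ℝ, (diagonal β - W.toBlocks₂₂).IsHermitian := fun β => by
    rw [IsHermitian, conjTranspose_eq_transpose_of_trivial]
    refine (isSymm_diagonal β).sub ?_
    ext i j; exact hW.apply _ _
  rw [stzMass, lintegral_pi_unit_sum ((measurable_stzDensity hcont η).ennreal_ofReal.ite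
    (measurableSet_posDef hcont hherm) measurable_const), stzMass, ← lintegral_const_mul _
    ((measurable_stzDensity hcont' _).ennreal_ofReal.ite
    (measurableSet_posDef hcont' hherm') measurable_const)]
  refine lintegral_congr fun β => ?_
  set D := diagonal β - W.toBlocks₂₂ with hD
  have hb : ∀ b : ℝ, diagonal (Sum.elim (fun _ => b) β) - W = bordered (b - c) ω D := by
    intro b
    ext i j
    rcases i with i | i <;> rcases j with j | j <;> simp [bordered, D, diagonal_apply, hω, c]
    · exact hW.apply _ _
    · rfl
  simp only [hb, posDef_bordered_iff]
  by_cases hDp : D.PosDef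
  · simp only [hDp, true_and, if_true]
    set q := c + ω ⬝ᵥ D⁻¹ *ᵥ ω with hq
    set z := η (Sum.inl ()) + ω ⬝ᵥ D⁻¹ *ᵥ (η ∘ Sum.inr) with hz
    have hz0 : 0 ≤ z := by
      refine add_nonneg (hη _) (Finset.sum_nonneg fun i _ => mul_nonneg (hoff _ _ (by simp)) ?_)
      have : 0 ≤ D⁻¹ *ᵥ (η ∘ Sum.inr) := by
        refine nonneg_of_posDef_mulVec_nonneg hDp (fun i j hij => ?_) ?_
        · simp only [D, Matrix.sub_apply, diagonal_apply, hij, if_false, zero_sub, neg_nonpos]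
          exact hoff (Sum.inr i) (Sum.inr j) (by simpa using hij)
        · rw [mulVec_mulVec, mul_nonsing_inv _ hDp.det_pos.ne'.isUnit, one_mulVec]
          exact fun i => hη _
      exact this i
    have hη' : η = Sum.elim (fun _ => η (Sum.inl ())) (η ∘ Sum.inr) := by
      ext i; rcases i with i | i <;> rfl
    have h1 : ∀ b : ℝ, (if 0 < b - c - ω ⬝ᵥ D⁻¹ *ᵥ ω then
        ENNReal.ofReal (stzDensity (bordered (b - c) ω D) η) else 0) =
        (Set.Ioi (0 : ℝ)).indicator (fun y => ENNReal.ofReal (exp (2 * z) *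
          stzDensity D (η ∘ Sum.inr + ω)) * ENNReal.ofReal (exp (-(y + z ^ 2 / y)) / √y)) (b - q) := by
      intro b
      have hy : b - q = b - c - ω ⬝ᵥ D⁻¹ *ᵥ ω := by rw [hq]; ring
      simp only [Set.indicator_apply, Set.mem_Ioi, hy]
      split_ifs with hpos
      · rw [hη', stzDensity_bordered (b - c) _ ω _ hDp rfl hpos hz, ENNReal.ofReal_mul]
        · rfl
        · exact mul_nonneg (exp_pos _).le (div_nonneg (exp_pos _).le (sqrt_nonneg _))
      · rfl
    simp_rw [h1]
    rw [lintegral_sub_right_eq_self (fun b : ℝ => (Set.Ioi (0 : ℝ)).indicator (fun y =>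
        ENNReal.ofReal (exp (2 * z) *
          stzDensity D (η ∘ Sum.inr + ω)) * ENNReal.ofReal (exp (-(y + z ^ 2 / y)) / √y)) b) q,
      lintegral_indicator measurableSet_Ioi, lintegral_const_mul _ (by fun_prop),
      lintegral_invGaussian hz0, ← ENNReal.ofReal_mul, ← ENNReal.ofReal_mul (sqrt_nonneg _)]
    · congr 1
      rw [Real.exp_neg]
      field_simp
    · exact mul_nonneg (exp_pos _).le (div_nonneg (exp_pos _).le (sqrt_nonneg _))
  · simp [hDp]

lemma stzMass_fin (n : ℕ) (W : Matrix (Fin n) (Fin n) ℝ) (hW : W.IsSymm)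
    (hoff : ∀ i j, i ≠ j → 0 ≤ W i j) (η : Fin n → ℝ) (hη : 0 ≤ η) :
    stzMass W η = ENNReal.ofReal √π ^ n := by
  induction n with
  | zero =>
    rw [stzMass, lintegral_empty_pi, if_pos]
    · simp [stzDensity]
    · exact .of_dotProduct_mulVec_pos (by ext i; exact isEmptyElim i)
        fun x hx => (hx (Subsingleton.elim _ _)).elim
  | succ n ih =>
    have e : Unit ⊕ Fin n ≃ Fin (n + 1) := Fintype.equivOfCardEq (by simp [add_comm])
    rw [stzMass_reindex e, stzMass_unit_sum _ (hW.submatrix e)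
      (fun i j hij => hoff _ _ (by simpa using hij)) (η ∘ e) fun i => hη _, ih, pow_succ']
    · ext i j; exact hW.apply _ _
    · intro i j hij
      exact hoff (e (Sum.inr i)) (e (Sum.inr j)) (by simpa using hij)
    · exact add_nonneg (fun i => hη _) fun i => hoff _ _ (by simp)

/-- The Sabot–Tarrès–Zeng integral. -/
theorem stzMass_eq (W : Matrix U U ℝ) (hW : W.IsSymm)
    (hoff : ∀ i j, i ≠ j → 0 ≤ W i j) (η : U → ℝ) (hη : 0 ≤ η) :
    stzMass W η = ENNReal.ofReal √π ^ Fintype.card U := by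
  rw [stzMass_reindex (Fintype.equivFin U).symm, stzMass_fin _ _ (hW.submatrix _)]
  · intro i j hij; exact hoff _ _ (by simpa using hij)
  · exact fun i => hη _
end STZ

section Potential
open Matrix
variable {U : Type*} [Fintype U] [DecidableEq U]

/-- The potential `β` for which `s` solves `(β - W) s = η`. -/
def potential (W : Matrix U U ℝ) (η s : U → ℝ) (i : U) : ℝ := ((W *ᵥ s) i + η i) / s i

lemma schrodinger_mulVec {W : Matrix U U ℝ} {η s : U → ℝ} (hs : ∀ i, 0 < s i) :
    (diagonal (potential W η s) - W) *ᵥ s = η := by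
  ext i
  rw [Matrix.sub_mulVec, Pi.sub_apply, mulVec_diagonal, potential,
    div_mul_cancel₀ _ (hs i).ne', add_sub_cancel_left]

lemma schrodinger_quadForm {W : Matrix U U ℝ} (hW : W.IsSymm) {η s : U → ℝ} (hs : ∀ i, 0 < s i)
    (v : U → ℝ) :
    v ⬝ᵥ (diagonal (potential W η s) - W) *ᵥ v =
      (∑ i, ∑ j, W i j * (s i * s j) * (v i / s i - v j / s j) ^ 2) / 2
        + ∑ i, η i * s i * (v i / s i) ^ 2 := by
  have h1 : ∀ i j, W i j * (s i * s j) * (v i / s i - v j / s j) ^ 2 =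
      W i j * s j / s i * v i ^ 2 + W j i * s i / s j * v j ^ 2 - 2 * (v i * (W i j * v j)) := by
    intro i j
    have := hs i; have := hs j
    rw [hW.apply i j]
    field_simp
    ring
  have h2 : ∑ i, ∑ j, W j i * s i / s j * v j ^ 2 = ∑ i, ∑ j, W i j * s j / s i * v i ^ 2 :=
    Finset.sum_comm
  simp_rw [h1, Finset.sum_sub_distrib, Finset.sum_add_distrib, h2]
  rw [Matrix.sub_mulVec, dotProduct_sub]
  simp_rw [dotProduct, mulVec_diagonal, mulVec, dotProduct, potential]
  have h3 : ∀ i, v i * (((W *ᵥ s) i + η i) / s i * v i) =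
     ∑ j, W i j * s j / s i * v i ^ 2 + η i * s i * (v i / s i) ^ 2 := by
    intro i
    have := hs i
    rw [← Finset.sum_mul, ← Finset.sum_div]
    simp only [mulVec, dotProduct]
    field_simp
  simp_rw [h3, Finset.sum_add_distrib, ← Finset.mul_sum]
  ring

/-- Every nonempty set of vertices is joined to its complement or to the source `η`. -/
def LeavesEverySet (W : Matrix U U ℝ) (η : U → ℝ) : Prop :=
  ∀ S : Set U, S.Nonempty → ∃ i ∈ S, 0 < η i ∨ ∃ j ∉ S, 0 < W i j

lemma isHermitian_schrodinger {W : Matrix U U ℝ} (hW : W.IsSymm) (β : U → ℝ) :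
    (diagonal β - W).IsHermitian :=
  (isHermitian_diagonal β).sub (by rw [IsHermitian, conjTranspose_eq_transpose_of_trivial, hW.eq])

lemma posDef_schrodinger {W : Matrix U U ℝ} (hW : W.IsSymm) (hoff : ∀ i j, 0 ≤ W i j)
    {η s : U → ℝ} (hη : 0 ≤ η) (hc : LeavesEverySet W η) (hs : ∀ i, 0 < s i) :
    (diagonal (potential W η s) - W).PosDef := by
  have hT : ∀ v : U → ℝ, ∀ i j, 0 ≤ W i j * (s i * s j) * (v i / s i - v j / s j) ^ 2 :=
    fun v i j => by have := hoff i j; have := hs i; have := hs j; positivity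
  have hE : ∀ v : U → ℝ, ∀ i, 0 ≤ η i * s i * (v i / s i) ^ 2 :=
    fun v i => by have : 0 ≤ η i := hη i; have := hs i; positivity
  refine PosDef.of_dotProduct_mulVec_pos ?_ fun v hv => ?_
  · exact isHermitian_schrodinger hW _
  rw [star_trivial, schrodinger_quadForm hW hs]
  have h1 : 0 ≤ ∑ i, ∑ j, W i j * (s i * s j) * (v i / s i - v j / s j) ^ 2 :=
    Finset.sum_nonneg fun i _ => Finset.sum_nonneg fun j _ => hT v i j
  have h2 : 0 ≤ ∑ i, η i * s i * (v i / s i) ^ 2 := Finset.sum_nonneg fun i _ => hE v i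
  obtain ⟨k, hk⟩ := Function.ne_iff.1 hv
  have hk0 : v k / s k ≠ 0 := div_ne_zero hk (hs k).ne'
  obtain ⟨i, hi, h⟩ := hc {i | v i / s i = v k / s k} ⟨k, rfl⟩
  rw [Set.mem_ofPred_eq] at hi
  rcases h with h | ⟨j, hj, h⟩
  · have : 0 < ∑ i, η i * s i * (v i / s i) ^ 2 := by
      refine Finset.sum_pos' (fun i _ => hE v i) ⟨i, Finset.mem_univ _, ?_⟩
      rw [hi]; have := hs i; positivity
    positivity
  · have : 0 < ∑ i, ∑ j, W i j * (s i * s j) * (v i / s i - v j / s j) ^ 2 := by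
      refine Finset.sum_pos' (fun i _ => Finset.sum_nonneg fun j _ => hT v i j)
        ⟨i, Finset.mem_univ _, ?_⟩
      refine Finset.sum_pos' (fun j _ => hT v i j) ⟨j, Finset.mem_univ _, ?_⟩
      have hne : v i / s i - v j / s j ≠ 0 := by
        rw [hi, sub_ne_zero]; exact fun h => hj h.symm
      have := hs i; have := hs j
      positivity
    positivity

lemma inv_mulVec_pos {W : Matrix U U ℝ} (hoff : ∀ i j, 0 ≤ W i j)
    {η β : U → ℝ} (hη : 0 ≤ η) (hc : LeavesEverySet W η) (hβ : (diagonal β - W).PosDef) (i : U) :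
    0 < ((diagonal β - W)⁻¹ *ᵥ η) i := by
  set s := (diagonal β - W)⁻¹ *ᵥ η with hs
  have hu : IsUnit (diagonal β - W).det := hβ.det_pos.ne'.isUnit
  have hHs : (diagonal β - W) *ᵥ s = η := by
    rw [hs, mulVec_mulVec, mul_nonsing_inv _ hu, one_mulVec]
  have h0 : 0 ≤ s := by
    refine nonneg_of_posDef_mulVec_nonneg hβ (fun i j hij => ?_) (hHs ▸ hη)
    simp [hij, hoff i j]
  by_contra hi
  obtain ⟨j, hj, h⟩ := hc {i | s i = 0} ⟨i, le_antisymm (not_lt.1 hi) (h0 i)⟩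
  rw [Set.mem_ofPred_eq] at hj
  have hj' := congrFun hHs j
  rw [Matrix.sub_mulVec, Pi.sub_apply, mulVec_diagonal, hj, mul_zero, zero_sub] at hj'
  have hWs : 0 ≤ (W *ᵥ s) j := Finset.sum_nonneg fun k _ => mul_nonneg (hoff j k) (h0 k)
  rcases h with h | ⟨k, hk, h⟩
  · linarith
  · have : 0 < (W *ᵥ s) j := by
      refine Finset.sum_pos' (fun k _ => mul_nonneg (hoff j k) (h0 k)) ⟨k, Finset.mem_univ _, ?_⟩
      exact mul_pos h (lt_of_le_of_ne (h0 k) (Ne.symm hk))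
    have := hη j
    simp only [Pi.zero_apply] at this
    linarith

lemma inv_mulVec_schrodinger {W : Matrix U U ℝ} (hW : W.IsSymm) (hoff : ∀ i j, 0 ≤ W i j)
    {η s : U → ℝ} (hη : 0 ≤ η) (hc : LeavesEverySet W η) (hs : ∀ i, 0 < s i) :
    (diagonal (potential W η s) - W)⁻¹ *ᵥ η = s := by
  have hu : IsUnit (diagonal (potential W η s) - W).det :=
    (posDef_schrodinger hW hoff hη hc hs).det_pos.ne'.isUnit
  conv_lhs => rw [← schrodinger_mulVec (W := W) (η := η) hs]
  rw [schrodinger_mulVec hs]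
  nth_rewrite 2 [← schrodinger_mulVec (W := W) (η := η) hs]
  rw [mulVec_mulVec, nonsing_inv_mul _ hu, one_mulVec]

lemma potential_inv_mulVec {W : Matrix U U ℝ} (hoff : ∀ i j, 0 ≤ W i j)
    {η β : U → ℝ} (hη : 0 ≤ η) (hc : LeavesEverySet W η) (hβ : (diagonal β - W).PosDef) :
    potential W η ((diagonal β - W)⁻¹ *ᵥ η) = β := by
  have hs := inv_mulVec_pos hoff hη hc hβ
  set s := (diagonal β - W)⁻¹ *ᵥ η with hs'
  have hHs : (diagonal β - W) *ᵥ s = η := by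
    rw [hs', mulVec_mulVec, mul_nonsing_inv _ hβ.det_pos.ne'.isUnit, one_mulVec]
  ext i
  rw [potential, div_eq_iff (hs i).ne', ← congrFun hHs i, Matrix.sub_mulVec, Pi.sub_apply,
      mulVec_diagonal]
  ring

lemma potential_image {W : Matrix U U ℝ} (hW : W.IsSymm) (hoff : ∀ i j, 0 ≤ W i j)
    {η : U → ℝ} (hη : 0 ≤ η) (hc : LeavesEverySet W η) :
    potential W η '' {s | ∀ i, 0 < s i} = {β | (diagonal β - W).PosDef} := by
  ext β
  refine ⟨?_, fun hβ => ⟨_, inv_mulVec_pos hoff hη hc hβ, potential_inv_mulVec hoff hη hc hβ⟩⟩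
  rintro ⟨s, hs, rfl⟩
  exact posDef_schrodinger hW hoff hη hc hs

lemma potential_injOn {W : Matrix U U ℝ} (hW : W.IsSymm) (hoff : ∀ i j, 0 ≤ W i j)
    {η : U → ℝ} (hη : 0 ≤ η) (hc : LeavesEverySet W η) :
    Set.InjOn (potential W η) {s | ∀ i, 0 < s i} := fun s hs t ht h => by
  rw [← inv_mulVec_schrodinger hW hoff hη hc hs, h, inv_mulVec_schrodinger hW hoff hη hc ht]

lemma hasFDerivAt_potential (W : Matrix U U ℝ) (η : U → ℝ) {s : U → ℝ} (hs : ∀ i, 0 < s i) :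
    HasFDerivAt (potential W η)
      (-(diagonal s⁻¹ * (diagonal (potential W η s) - W))).toLin'.toContinuousLinearMap s := by
  rw [hasFDerivAt_pi']
  intro i
  have h1 : HasFDerivAt (fun s : U → ℝ => (W *ᵥ s) i + η i)
      ((ContinuousLinearMap.proj i).comp W.toLin'.toContinuousLinearMap) s := by
    refine HasFDerivAt.add_const (f := fun s : U → ℝ => (W *ᵥ s) i) (η i) ?_
    exact ((ContinuousLinearMap.proj (R := ℝ) (φ := fun _ : U => ℝ) i).comp
      W.toLin'.toContinuousLinearMap).hasFDerivAt
  have h2 : HasFDerivAt (fun s : U → ℝ => (s i)⁻¹) _ s :=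
    (hasDerivAt_inv (hs i).ne').comp_hasFDerivAt s
      (ContinuousLinearMap.proj (R := ℝ) (φ := fun _ : U => ℝ) i).hasFDerivAt
  refine ((h1.mul h2).congr_of_eventuallyEq (Eventually.of_forall fun s => ?_)).congr_fderiv ?_
  · simp only [potential, div_eq_mul_inv, Pi.mul_apply]
  · ext v
    have := (hs i).ne'
    simp only [_root_.add_apply, _root_.smul_apply, ContinuousLinearMap.comp_apply,
      ContinuousLinearMap.proj_apply, LinearMap.coe_toContinuousLinearMap', Matrix.toLin'_apply,
      Matrix.neg_mulVec, ← Matrix.mulVec_mulVec, Matrix.sub_mulVec, mulVec_diagonal, Pi.neg_apply,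
      Pi.sub_apply, Pi.inv_apply, smul_eq_mul, potential]
    field_simp
    ring

lemma abs_det_fderiv_potential {W : Matrix U U ℝ} (hW : W.IsSymm) (hoff : ∀ i j, 0 ≤ W i j)
    {η s : U → ℝ} (hη : 0 ≤ η) (hc : LeavesEverySet W η) (hs : ∀ i, 0 < s i) :
    |(-(diagonal s⁻¹ * (diagonal (potential W η s) - W))).toLin'.toContinuousLinearMap.det| =
      (∏ i, (s i)⁻¹) * (diagonal (potential W η s) - W).det := by
  rw [LinearMap.det_toContinuousLinearMap, LinearMap.det_toLin', det_neg, abs_mul, abs_pow, abs_neg,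
    abs_one, one_pow, one_mul, det_mul, det_diagonal, abs_of_nonneg]
  · rfl
  · refine mul_nonneg (Finset.prod_nonneg fun i _ => (inv_pos.2 (hs i)).le) ?_
    exact (posDef_schrodinger hW hoff hη hc hs).det_pos.le

lemma lintegral_potential {W : Matrix U U ℝ} (hW : W.IsSymm) (hoff : ∀ i j, 0 ≤ W i j)
    {η : U → ℝ} (hη : 0 ≤ η) (hc : LeavesEverySet W η) :
    ∫⁻ s in {s : U → ℝ | ∀ i, 0 < s i}, ENNReal.ofReal ((∏ i, (s i)⁻¹) *
        √(diagonal (potential W η s) - W).det * exp (-(∑ i, potential W η s i + η ⬝ᵥ s)))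
      = ENNReal.ofReal (√π ^ Fintype.card U * exp (-(∑ i, ∑ j, W i j + 2 * ∑ i, η i))) := by
  have hS : MeasurableSet {s : U → ℝ | ∀ i, 0 < s i} := by
    simp only [Set.ofPred_forall]
    exact MeasurableSet.iInter fun i => measurableSet_lt measurable_const (measurable_pi_apply i)
  have hmain := lintegral_image_eq_lintegral_abs_det_fderiv_mul volume hS
    (fun s hs => (hasFDerivAt_potential W η hs).hasFDerivWithinAt) (potential_injOn hW hoff hη hc)
    (fun β => ENNReal.ofReal (stzDensity (diagonal β - W) η))
  have hmass := stzMass_eq W hW (fun i j _ => hoff i j) η hη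
  have hset : MeasurableSet {β : U → ℝ | (diagonal β - W).PosDef} :=
    measurableSet_posDef (by fun_prop) (isHermitian_schrodinger hW)
  rw [potential_image hW hoff hη hc, ← lintegral_indicator hset] at hmain
  have h1 : stzMass W η = ∫⁻ β, Set.indicator {β : U → ℝ | (diagonal β - W).PosDef}
    (fun β => ENNReal.ofReal (stzDensity (diagonal β - W) η)) β := rfl
  rw [← h1, hmass] at hmain
  rw [mul_comm, ENNReal.ofReal_mul (exp_pos _).le, ENNReal.ofReal_pow (sqrt_nonneg _), hmain,
    ← lintegral_const_mul' _ _ ENNReal.ofReal_ne_top]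
  refine setLIntegral_congr_fun hS fun s hs => ?_
  have hpd := posDef_schrodinger hW hoff hη hc hs
  rw [abs_det_fderiv_potential hW hoff hη hc hs, ← ENNReal.ofReal_mul,
      ← ENNReal.ofReal_mul (exp_pos _).le]
  · congr 1
    have e1 : (1 : U → ℝ) ⬝ᵥ (diagonal (potential W η s) - W) *ᵥ 1 =
        ∑ i, potential W η s i - ∑ i, ∑ j, W i j := by
      rw [Matrix.sub_mulVec, dotProduct_sub]
      simp [dotProduct, mulVec, diagonal_apply]
    have e2 : (1 : U → ℝ) ⬝ᵥ η = ∑ i, η i := by simp [dotProduct]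
    rw [stzDensity, inv_mulVec_schrodinger hW hoff hη hc hs, e1, e2]
    set d := (diagonal (potential W η s) - W).det
    have hd : 0 < √d := sqrt_pos.2 hpd.det_pos
    have hd2 : d = √d * √d := (mul_self_sqrt hpd.det_pos.le).symm
    set F := ∑ i, potential W η s i
    rw [show -(F + η ⬝ᵥ s) = -(∑ i, ∑ j, W i j + 2 * ∑ i, η i) +
      -(F - ∑ i, ∑ j, W i j + η ⬝ᵥ s - 2 * ∑ i, η i) by ring, Real.exp_add]
    nth_rewrite 2 [hd2]
    field_simp
  · exact mul_nonneg (Finset.prod_nonneg fun i _ => (inv_pos.2 (hs i)).le) hpd.det_pos.le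

end Potential

section MatrixTree
open Matrix

/-- The off-diagonal part of the Laplacian with the row and column of `x` removed. -/
def redAdj (G : SimpleGraph V) [DecidableRel G.Adj] (x : V) (w : Sym2 V → ℝ) :
    Matrix {v : V // v ≠ x} {v : V // v ≠ x} ℝ :=
  of fun i j => if G.Adj i j then w s((i : V), (j : V)) else 0

/-- The incidence matrix of a map assigning to each vertex other than `x` a successor. -/
def succMatrix {x : V} (f : {v : V // v ≠ x} → V) : Matrix {v : V // v ≠ x} {v : V // v ≠ x} ℝ :=
  of fun i k => (if i = k then 1 else 0) - if f i = k then 1 else 0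

/-- Following `f` leads from every vertex to `x`. -/
def LeadsToRoot {x : V} (f : {v : V // v ≠ x} → V) : Prop :=
  ∃ d : V → ℕ, ∀ i, d (f i) < d i

lemma det_laplacian_eq_sum (G : SimpleGraph V) [DecidableRel G.Adj] (x : V) (w : Sym2 V → ℝ) :
    (diagonal (fun i : {v : V // v ≠ x} => vw G w i) - redAdj G x w).det =
      ∑ f ∈ Fintype.piFinset fun i : {v : V // v ≠ x} => G.neighborFinset i,
        (∏ i : {v : V // v ≠ x}, w s((i : V), f i)) * (succMatrix f).det := by
  have h : diagonal (fun i : {v : V // v ≠ x} => vw G w i) - redAdj G x w =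
      fun i : {v : V // v ≠ x} => ∑ j ∈ G.neighborFinset i, w s((i : V), j) •
        fun k : {v : V // v ≠ x} => (if i = k then (1 : ℝ) else 0) - if j = k then 1 else 0 := by
    ext i k
    simp only [Matrix.sub_apply, diagonal_apply, redAdj, of_apply, Finset.sum_apply, Pi.smul_apply,
      smul_eq_mul, mul_sub, Finset.sum_sub_distrib, vw]
    congr 1
    · split_ifs <;> simp
    · simp
  have h2 := (detRowAlternating (R := ℝ) (n := {v : V // v ≠ x})).toMultilinearMap.map_sum_finset
    (fun (i : {v : V // v ≠ x}) (j : V) => w s((i : V), j) •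
        fun k : {v : V // v ≠ x} => (if i = k then (1 : ℝ) else 0) - if j = k then 1 else 0)
    (fun i => G.neighborFinset i)
  rw [h]
  refine h2.trans (Finset.sum_congr rfl fun f _ => ?_)
  exact (detRowAlternating (R := ℝ) (n := {v : V // v ≠ x})).toMultilinearMap.map_smul_univ _ _

lemma det_succMatrix_of_leadsToRoot {x : V} {f : {v : V // v ≠ x} → V} (hf : LeadsToRoot f) :
    (succMatrix f).det = 1 := by
  obtain ⟨d, hd⟩ := hf
  have hbt : (succMatrix f).BlockTriangular fun i => OrderDual.toDual (d i) := by
    intro i j hij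
    have hij' : d i < d j := hij
    have h1 : i ≠ j := by rintro rfl; exact lt_irrefl _ hij'
    have h2 : f i ≠ j := fun h => by have := hd i; rw [h] at this; omega
    simp [succMatrix, h1, h2]
  rw [hbt.det]
  refine Finset.prod_eq_one fun k _ => ?_
  rw [show (succMatrix f).toSquareBlock (fun i => OrderDual.toDual (d i)) k = 1 from ?_, det_one]
  ext ⟨i, hi⟩ ⟨j, hj⟩
  have h2 : f i ≠ j := fun h => by
    have := hd i; rw [h] at this
    have h3 : d i = d j := hi.trans hj.symm
    omega
  simp [succMatrix, toSquareBlock_def, h2, one_apply]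

lemma leadsToRoot_of_det_ne_zero {x : V} {f : {v : V // v ≠ x} → V}
    (hf : (succMatrix f).det ≠ 0) : LeadsToRoot f := by
  set g : V → V := fun v => if h : v ≠ x then f ⟨v, h⟩ else x with hg
  have hgf : ∀ i : {v : V // v ≠ x}, g i = f i := fun i => by simp [hg, i.2]
  have hr : ∀ v, ∃ k, g^[k] v = x := by
    by_contra hne
    push Not at hne
    obtain ⟨v, hv⟩ := hne
    refine hf (exists_mulVec_eq_zero_iff.1 ⟨fun i => if ∃ k, g^[k] i = x then 0 else 1, ?_, ?_⟩)
    · refine Function.ne_iff.2 ⟨⟨v, hv 0⟩, ?_⟩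
      simp [hv]
    · ext i
      have hstep : (∃ k, g^[k] i = x) ↔ ∃ k, g^[k] (f i) = x := by
        constructor
        · rintro ⟨k, hk⟩
          cases k with
          | zero => exact absurd hk i.2
          | succ k => exact ⟨k, by rwa [Function.iterate_succ_apply, hgf] at hk⟩
        · rintro ⟨k, hk⟩
          exact ⟨k + 1, by rwa [Function.iterate_succ_apply, hgf]⟩
      simp only [mulVec, dotProduct, succMatrix, of_apply, sub_mul, Finset.sum_sub_distrib,
        Pi.zero_apply, ite_mul, one_mul, zero_mul, Finset.sum_ite_eq, Finset.mem_univ, if_true]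
      rw [if_congr hstep rfl rfl, sub_eq_zero]
      by_cases hfx : f i = x
      · rw [if_pos ⟨0, hfx⟩, Finset.sum_eq_zero]
        intro k _
        rw [if_neg]
        rw [hfx]; exact k.2.symm
      · rw [Finset.sum_eq_single ⟨f i, hfx⟩]
        · simp
        · intro k _ hk
          rw [if_neg]
          rintro h; exact hk (Subtype.ext h.symm)
        · simp
  refine ⟨fun v => Nat.find (hr v), fun i => ?_⟩
  have h1 := Nat.find_spec (hr i)
  have h0 : Nat.find (hr i) ≠ 0 := fun h => by rw [h] at h1; exact i.2 h1
  obtain ⟨k, hk⟩ := Nat.exists_eq_succ_of_ne_zero h0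
  rw [hk, Function.iterate_succ_apply, hgf] at h1
  have := Nat.find_min' (hr (f i)) h1
  simp only []
  omega

lemma LeadsToRoot.edge_injective {x : V} {f : {v : V // v ≠ x} → V} (hf : LeadsToRoot f) :
    Function.Injective fun i : {v : V // v ≠ x} => s((i : V), f i) := by
  obtain ⟨d, hd⟩ := hf
  intro i j hij
  rcases Sym2.eq_iff.1 hij with ⟨h, -⟩ | ⟨h1, h2⟩
  · exact Subtype.ext h
  · have := hd i; have := hd j; rw [h2] at *; rw [← h1] at *; omega

/-- The edge set traced out by a successor map. -/
def succEdges {x : V} (f : {v : V // v ≠ x} → V) : Finset (Sym2 V) :=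
  Finset.univ.image fun i : {v : V // v ≠ x} => s((i : V), f i)

lemma LeadsToRoot.card_succEdges {x : V} {f : {v : V // v ≠ x} → V} (hf : LeadsToRoot f) :
    (succEdges f).card + 1 = Fintype.card V := by
  rw [succEdges, Finset.card_image_of_injective _ hf.edge_injective, Finset.card_univ,
    Fintype.card_subtype_compl, Fintype.card_subtype_eq]
  have : 0 < Fintype.card V := Fintype.card_pos_iff.2 ⟨x⟩
  omega

lemma card_edgeSet_fromEdgeSet {F : Finset (Sym2 V)} (hF : ∀ e ∈ F, ¬ e.IsDiag) :
    Nat.card (SimpleGraph.fromEdgeSet (F : Set (Sym2 V))).edgeSet = F.card := by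
  rw [SimpleGraph.edgeSet_fromEdgeSet, sdiff_eq_left.2]
  · simp
  · rw [Set.disjoint_left]; intro e he hd; exact hF e he hd

lemma LeadsToRoot.connected {x : V} {f : {v : V // v ≠ x} → V} (hf : LeadsToRoot f) :
    (SimpleGraph.fromEdgeSet (succEdges f : Set (Sym2 V))).Connected := by
  obtain ⟨d, hd⟩ := hf
  set T := SimpleGraph.fromEdgeSet (succEdges f : Set (Sym2 V))
  have hr : ∀ n v, d v ≤ n → T.Reachable v x := by
    intro n
    induction n with
    | zero =>
      intro v hv
      by_cases h : v = x
      · rw [h]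
      · have := hd ⟨v, h⟩; simp at this; omega
    | succ n ih =>
      intro v hv
      by_cases h : v = x
      · rw [h]
      · have h1 := hd ⟨v, h⟩
        simp only at h1
        refine SimpleGraph.Reachable.trans (SimpleGraph.Adj.reachable ?_) (ih (f ⟨v, h⟩) (by omega))
        rw [SimpleGraph.fromEdgeSet_adj]
        refine ⟨?_, fun h2 => ?_⟩
        · exact Finset.mem_coe.2 (Finset.mem_image.2 ⟨⟨v, h⟩, Finset.mem_univ _, rfl⟩)
        · rw [← h2] at h1; exact lt_irrefl _ h1
  have : Nonempty V := ⟨x⟩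
  exact ⟨fun u v => (hr _ u le_rfl).trans (hr _ v le_rfl).symm⟩

lemma succEdges_mem_spanningTrees {G : SimpleGraph V} [DecidableRel G.Adj] {x : V}
    {f : {v : V // v ≠ x} → V} (hf : LeadsToRoot f) (hG : ∀ i : {v : V // v ≠ x}, G.Adj i (f i)) :
    succEdges f ∈ spanningTrees G := by
  have hsub : succEdges f ⊆ G.edgeFinset := by
    intro e he
    obtain ⟨i, -, rfl⟩ := Finset.mem_image.1 he
    simpa using hG i
  rw [spanningTrees, Finset.mem_filter, Finset.mem_powerset]
  refine ⟨hsub, SimpleGraph.isTree_iff_connected_and_card.2 ⟨hf.connected, ?_⟩⟩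
  rw [card_edgeSet_fromEdgeSet, hf.card_succEdges, Nat.card_eq_fintype_card]
  intro e he
  exact G.not_isDiag_of_mem_edgeFinset (hsub he)

lemma LeadsToRoot.eq_of_succEdges_eq {x : V} {f g : {v : V // v ≠ x} → V} (hf : LeadsToRoot f)
    (h : succEdges f = succEdges g) : f = g := by
  obtain ⟨d, hd⟩ := hf
  have key : ∀ n, ∀ i : {v : V // v ≠ x}, d i ≤ n → f i = g i := by
    intro n
    induction n with
    | zero => intro i hi; have := hd i; omega
    | succ n ih =>
      intro i hi
      have hmem : s((i : V), f i) ∈ succEdges g := by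
        rw [← h]; exact Finset.mem_image.2 ⟨i, Finset.mem_univ _, rfl⟩
      obtain ⟨j, -, hj⟩ := Finset.mem_image.1 hmem
      rcases Sym2.eq_iff.1 hj with ⟨h1, h2⟩ | ⟨h1, h2⟩
      · rw [← h2, Subtype.ext h1]
      · exfalso
        have h3 := hd i
        have h4 := hd j
        rw [← h1] at h3
        rw [ih j (by omega), h2] at h4
        omega
  funext i
  exact key _ i le_rfl

lemma exists_leadsToRoot {G : SimpleGraph V} [DecidableRel G.Adj] (x : V) {F : Finset (Sym2 V)}
    (hF : F ∈ spanningTrees G) :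
    ∃ f : {v : V // v ≠ x} → V, (∀ i : {v : V // v ≠ x}, G.Adj i (f i)) ∧ LeadsToRoot f ∧ succEdges f = F := by
  rw [spanningTrees, Finset.mem_filter, Finset.mem_powerset] at hF
  obtain ⟨hsub, hT⟩ := hF
  set T := SimpleGraph.fromEdgeSet (F : Set (Sym2 V)) with hTdef
  have hstep : ∀ i : {v : V // v ≠ x}, ∃ j, T.Adj i j ∧ T.dist j x < T.dist i x := by
    intro i
    obtain ⟨i, hi⟩ := i
    obtain ⟨p, hp⟩ := hT.connected.exists_walk_length_eq_dist i x
    cases p with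
    | nil => exact absurd rfl hi
    | cons h q =>
      refine ⟨_, h, ?_⟩
      rw [← hp, SimpleGraph.Walk.length_cons]
      exact Nat.lt_succ_of_le (SimpleGraph.dist_le q)
  choose f hadj hdist using hstep
  have hf : LeadsToRoot f := ⟨fun v => T.dist v x, hdist⟩
  have hFf : succEdges f ⊆ F := by
    intro e he
    obtain ⟨i, -, rfl⟩ := Finset.mem_image.1 he
    exact ((SimpleGraph.fromEdgeSet_adj _).1 (hadj i)).1
  refine ⟨f, fun i => ?_, hf, Finset.eq_of_subset_of_card_le hFf ?_⟩
  · have := hsub (hFf (Finset.mem_image.2 ⟨i, Finset.mem_univ _, rfl⟩))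
    simpa using this
  · have h1 := (SimpleGraph.isTree_iff_connected_and_card.1 hT).2
    rw [card_edgeSet_fromEdgeSet, Nat.card_eq_fintype_card, ← hf.card_succEdges] at h1
    · omega
    · intro e he
      exact G.not_isDiag_of_mem_edgeFinset (hsub he)

/-- The weighted matrix-tree theorem. -/
theorem tau_eq_det (G : SimpleGraph V) [DecidableRel G.Adj] (x : V) (w : Sym2 V → ℝ) :
    tau G w = (diagonal (fun i : {v : V // v ≠ x} => vw G w i) - redAdj G x w).det := by
  rw [det_laplacian_eq_sum, ← Finset.sum_filter_add_sum_filter_not _ (fun f => LeadsToRoot f)]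
  rw [Finset.sum_eq_zero (s := Finset.filter (fun f => ¬ LeadsToRoot f) _), add_zero]
  · symm
    refine Finset.sum_nbij succEdges (fun f hf => ?_) (fun f hf g hg h => ?_) (fun F hF => ?_)
      (fun f hf => ?_)
    · rw [Finset.mem_filter, Fintype.mem_piFinset] at hf
      exact succEdges_mem_spanningTrees hf.2 fun i => by simpa using hf.1 i
    · exact (Finset.mem_filter.1 hf).2.eq_of_succEdges_eq h
    · obtain ⟨f, h1, h2, h3⟩ := exists_leadsToRoot x (Finset.mem_coe.1 hF)
      refine ⟨f, ?_, h3⟩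
      rw [Finset.mem_coe, Finset.mem_filter, Fintype.mem_piFinset]
      exact ⟨fun i => by simpa using h1 i, h2⟩
    · have := (Finset.mem_filter.1 hf).2
      rw [det_succMatrix_of_leadsToRoot this, mul_one, succEdges,
        Finset.prod_image this.edge_injective.injOn]
  · intro f hf
    by_contra h
    exact (Finset.mem_filter.1 hf).2 (leadsToRoot_of_det_ne_zero (right_ne_zero_of_mul h))

end MatrixTree

section Orthant

/-- The open positive orthant. -/
def posOrthant (ι : Type*) : Set (ι → ℝ) := {x | ∀ i, 0 < x i}

lemma posOrthant_eq_pi (ι : Type*) : posOrthant ι = Set.univ.pi fun _ => Set.Ioi 0 := by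
  ext x; simp [posOrthant]

lemma measurableSet_posOrthant (ι : Type*) [Fintype ι] : MeasurableSet (posOrthant ι) := by
  rw [posOrthant_eq_pi]
  exact MeasurableSet.univ_pi fun _ => measurableSet_Ioi

lemma lintegral_pi_prod_fin {n : ℕ} (μ : Fin n → Measure ℝ) [∀ i, SigmaFinite (μ i)]
    (f : Fin n → ℝ → ℝ≥0∞) (hf : ∀ i, Measurable (f i)) :
    ∫⁻ x, ∏ i, f i (x i) ∂Measure.pi μ = ∏ i, ∫⁻ y, f i y ∂μ i := by
  induction n with
  | zero => simp
  | succ n ih =>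
    rw [(measurePreserving_piFinSuccAbove μ 0).symm.lintegral_map_equiv, Fin.prod_univ_succ,
      ← ih (fun j => μ j.succ) (fun j => f j.succ) fun j => hf _]
    rw [← lintegral_prod_mul (hf 0).aemeasurable (Finset.measurable_prod _
      fun i _ => (hf i.succ).comp (measurable_pi_apply i)).aemeasurable]
    refine lintegral_congr fun z => ?_
    rw [Fin.prod_univ_succ]
    simp [MeasurableEquiv.piFinSuccAbove]

lemma lintegral_pi_prod {ι : Type*} [Fintype ι] (μ : ι → Measure ℝ) [∀ i, SigmaFinite (μ i)]
    (f : ι → ℝ → ℝ≥0∞) (hf : ∀ i, Measurable (f i)) :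
    ∫⁻ x, ∏ i, f i (x i) ∂Measure.pi μ = ∏ i, ∫⁻ y, f i y ∂μ i := by
  set e := (Fintype.equivFin ι).symm
  rw [← e.prod_comp, ← lintegral_pi_prod_fin (fun j => μ (e j)) (fun j => f (e j)) fun j => hf _,
    (measurePreserving_piCongrLeft μ e).lintegral_map_equiv]
  refine lintegral_congr fun z => ?_
  rw [← e.prod_comp]
  simp [MeasurableEquiv.piCongrLeft]

lemma lintegral_posOrthant_prod {ι : Type*} [Fintype ι]
    (f : ι → ℝ → ℝ≥0∞) (hf : ∀ i, Measurable (f i)) :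
    ∫⁻ x in posOrthant ι, ∏ i, f i (x i) = ∏ i, ∫⁻ y in Set.Ioi 0, f i y := by
  rw [posOrthant_eq_pi, volume_pi, Measure.restrict_pi_pi, lintegral_pi_prod _ _ hf]

lemma lintegral_posOrthant_scale {ι : Type*} [Fintype ι] {c : ι → ℝ} (hc : ∀ i, 0 < c i)
    {f : (ι → ℝ) → ℝ≥0∞} (hf : Measurable f) :
    ∫⁻ x in posOrthant ι, f x =
      ENNReal.ofReal (∏ i, c i) * ∫⁻ x in posOrthant ι, f (fun i => c i * x i) := by
  have hp : 0 < ∏ i, c i := Finset.prod_pos fun i _ => hc i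
  rw [← lintegral_indicator (measurableSet_posOrthant ι),
    ← lintegral_indicator (measurableSet_posOrthant ι)]
  conv_lhs => rw [← Real.smul_map_diagonal_volume_pi (D := c) (by rw [Matrix.det_diagonal]; exact hp.ne')]
  rw [lintegral_smul_measure, Matrix.det_diagonal, abs_of_pos hp, smul_eq_mul, lintegral_map]
  · congr 1
    refine lintegral_congr fun x => ?_
    have h1 : Matrix.toLin' (Matrix.diagonal c) x = fun i => c i * x i := by
      ext i; simp [Matrix.mulVec_diagonal]
    rw [h1]
    have h2 : (fun i => c i * x i) ∈ posOrthant ι ↔ x ∈ posOrthant ι := by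
      simp only [posOrthant, Set.mem_ofPred_eq]
      exact forall_congr' fun i => by rw [mul_pos_iff_of_pos_left (hc i)]
    by_cases h : x ∈ posOrthant ι
    · rw [Set.indicator_of_mem h, Set.indicator_of_mem (h2.2 h)]
    · rw [Set.indicator_of_notMem h, Set.indicator_of_notMem (h2.not.2 h)]
  · exact hf.indicator (measurableSet_posOrthant ι)
  · exact (LinearMap.continuous_on_pi _).measurable

end Orthant

section GammaIntegrals

lemma lintegral_gamma {b r : ℝ} (hb : 0 < b) (hr : 0 < r) :
    ∫⁻ y in Set.Ioi (0 : ℝ), ENNReal.ofReal (y ^ (b - 1) * exp (-(r * y))) =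
      ENNReal.ofReal (Real.Gamma b * r ^ (-b)) := by
  have h := Real.integral_rpow_mul_exp_neg_mul_Ioi hb hr
  rw [← ofReal_integral_eq_lintegral_ofReal, h]
  · rw [one_div, Real.inv_rpow hr.le, Real.rpow_neg hr.le, mul_comm]
  · have := integrableOn_rpow_mul_exp_neg_mul_rpow (s := b - 1) (p := 1) (by linarith) one_pos hr
    simpa [IntegrableOn] using this
  · refine (ae_restrict_iff' measurableSet_Ioi).2 (Eventually.of_forall fun y hy => ?_)
    have : (0 : ℝ) < y := hy
    simp only [Pi.zero_apply]
    positivity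

lemma lintegral_inv_sq_gamma {b r : ℝ} (hb : 0 < b) (hr : 0 < r) :
    ∫⁻ s in Set.Ioi (0 : ℝ), ENNReal.ofReal (2 * s ^ (-(2 * b + 1)) * exp (-(r / s ^ 2))) =
      ENNReal.ofReal (Real.Gamma b * r ^ (-b)) := by
  rw [← lintegral_gamma hb hr]
  have hpos : ∀ᵐ y ∂volume.restrict (Set.Ioi (0 : ℝ)), 0 ≤ y ^ (b - 1) * exp (-(r * y)) := by
    refine (ae_restrict_iff' measurableSet_Ioi).2 (Eventually.of_forall fun y hy => ?_)
    have : (0 : ℝ) < y := hy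
    positivity
  have hint : IntegrableOn (fun y : ℝ => y ^ (b - 1) * exp (-(r * y))) (Set.Ioi 0) := by
    have := integrableOn_rpow_mul_exp_neg_mul_rpow (s := b - 1) (p := 1) (by linarith) one_pos hr
    simpa [IntegrableOn] using this
  have hcomp := integral_comp_rpow_Ioi (fun y : ℝ => y ^ (b - 1) * exp (-(r * y))) (p := -2) (by norm_num)
  have hint2 := (integrableOn_Ioi_comp_rpow_iff (fun y : ℝ => y ^ (b - 1) * exp (-(r * y)))
    (p := -2) (by norm_num)).2 hint
  rw [← ofReal_integral_eq_lintegral_ofReal hint hpos, ← hcomp,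
      ofReal_integral_eq_lintegral_ofReal hint2]
  · refine setLIntegral_congr_fun measurableSet_Ioi fun s hs => ?_
    have hs : (0 : ℝ) < s := hs
    simp only [smul_eq_mul]
    congr 1
    have h2 : s ^ (-2 : ℝ) = (s ^ 2)⁻¹ := by rw [Real.rpow_neg hs.le]; norm_num
    rw [show |(-2 : ℝ)| = 2 by norm_num, ← Real.rpow_mul hs.le, h2, div_eq_mul_inv,
      show -(2 * b + 1) = (-2 - 1) + (-2 * (b - 1)) by ring, Real.rpow_add hs]
    ring
  · refine (ae_restrict_iff' measurableSet_Ioi).2 (Eventually.of_forall fun y hy => ?_)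
    have : (0 : ℝ) < y := hy
    simp only [Pi.zero_apply, smul_eq_mul]
    positivity

end GammaIntegrals

section VertexWeights

lemma vw_eq_sum (G : SimpleGraph V) [DecidableRel G.Adj] (w : Sym2 V → ℝ) (v : V) :
    vw G w v = ∑ e ∈ G.edgeFinset, if v ∈ e then w e else 0 := by
  rw [← Finset.sum_filter, vw]
  refine Finset.sum_nbij (fun j => s(v, j)) (fun j hj => ?_) (fun i _ j _ h => ?_) (fun e he => ?_)
    fun _ _ => rfl
  · simpa using hj
  · rcases Sym2.eq_iff.1 h with ⟨-, h⟩ | ⟨h1, h2⟩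
    exacts [h, h2.trans h1]
  · rw [Finset.mem_coe, Finset.mem_filter] at he
    obtain ⟨he, hv⟩ := he
    obtain ⟨j, rfl⟩ := hv
    exact ⟨j, by simpa using he, rfl⟩

lemma vw_pos {G : SimpleGraph V} [DecidableRel G.Adj] {w : Sym2 V → ℝ}
    (hw : ∀ e ∈ G.edgeFinset, 0 < w e) {v : V} (hv : (G.neighborFinset v).Nonempty) :
    0 < vw G w v :=
  Finset.sum_pos (fun j hj => hw _ (by simpa using hj)) hv

lemma sum_mem_eq_ssum (G : SimpleGraph V) [DecidableRel G.Adj] (f : V → ℝ) {e : Sym2 V}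
    (he : e ∈ G.edgeFinset) : ∑ v, (if v ∈ e then f v else 0) = ssum f e := by
  induction e with
  | _ i j =>
  have hij : i ≠ j := G.ne_of_adj (by simpa using he)
  rw [← Finset.sum_filter, show Finset.univ.filter (· ∈ s(i, j)) = {i, j} by ext; simp,
    Finset.sum_pair hij]
  rfl

lemma sum_vw_mul (G : SimpleGraph V) [DecidableRel G.Adj] (w : Sym2 V → ℝ) (f : V → ℝ) :
    ∑ v, vw G w v * f v = ∑ e ∈ G.edgeFinset, w e * ssum f e := by
  simp_rw [vw_eq_sum, Finset.sum_mul]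
  rw [Finset.sum_comm]
  refine Finset.sum_congr rfl fun e he => ?_
  rw [← sum_mem_eq_ssum G f he, Finset.mul_sum]
  exact Finset.sum_congr rfl fun v _ => by split_ifs <;> simp

lemma sprod_pos {f : V → ℝ} (hf : ∀ v, 0 < f v) (e : Sym2 V) : 0 < sprod f e := by
  induction e with
  | _ i j => exact mul_pos (hf i) (hf j)

lemma prod_sprod_rpow (G : SimpleGraph V) [DecidableRel G.Adj] (B : Sym2 V → ℝ) {f : V → ℝ}
    (hf : ∀ v, 0 < f v) :
    ∏ e ∈ G.edgeFinset, sprod f e ^ B e = ∏ v, f v ^ vw G B v := by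
  have h1 : ∀ e, sprod f e ^ B e = exp (B e * ssum (fun v => log (f v)) e) := by
    intro e
    rw [Real.rpow_def_of_pos (sprod_pos hf e), mul_comm (B e)]
    induction e with
    | _ i j =>
      congr 2
      exact Real.log_mul (hf i).ne' (hf j).ne'
  simp_rw [h1]
  rw [← Real.exp_sum, ← sum_vw_mul, Real.exp_sum]
  exact Finset.prod_congr rfl fun v _ => by rw [Real.rpow_def_of_pos (hf v), mul_comm]

lemma sum_vw (G : SimpleGraph V) [DecidableRel G.Adj] (w : Sym2 V → ℝ) :
    ∑ v, vw G w v = 2 * ∑ e ∈ G.edgeFinset, w e := by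
  have h := sum_vw_mul G w fun _ => 1
  simp only [mul_one] at h
  rw [h, Finset.mul_sum]
  refine Finset.sum_congr rfl fun e _ => ?_
  induction e with
  | _ i j => change w _ * (1 + 1) = _; ring

end VertexWeights

section Conjugation
open Matrix
variable (G : SimpleGraph V) [DecidableRel G.Adj] (x : V)

/-- The edge weights towards the root `x`. -/
def rootSource (w : Sym2 V → ℝ) (i : {v : V // v ≠ x}) : ℝ :=
  if G.Adj i x then w s((i : V), x) else 0

/-- Extension of a vertex function by the value `1` at the root. -/
def rootExt (s : {v : V // v ≠ x} → ℝ) (v : V) : ℝ := if h : v ≠ x then s ⟨v, h⟩ else 1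

@[simp] lemma rootExt_coe (s : {v : V // v ≠ x} → ℝ) (i : {v : V // v ≠ x}) :
    rootExt x s i = s i := by simp [rootExt, i.2]

@[simp] lemma rootExt_root (s : {v : V // v ≠ x} → ℝ) : rootExt x s x = 1 := by simp [rootExt]

lemma rootExt_pos {s : {v : V // v ≠ x} → ℝ} (hs : ∀ i, 0 < s i) (v : V) : 0 < rootExt x s v := by
  unfold rootExt
  split_ifs
  exacts [hs _, one_pos]

lemma sum_neighborFinset_split (v : V) (h : V → ℝ) :
    ∑ j ∈ G.neighborFinset v, h j =
      ∑ j : {v : V // v ≠ x}, (if G.Adj v j then h j else 0) + if G.Adj v x then h x else 0 := by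
  rw [add_comm, ← Fintype.sum_eq_add_sum_subtype_ne (fun j => if G.Adj v j then h j else 0) x,
    ← Finset.sum_filter]
  congr 1
  ext; simp

variable (w : Sym2 V → ℝ) (s : {v : V // v ≠ x} → ℝ)

lemma vw_sprod_mul (f : V → ℝ) (v : V) :
    vw G (fun e => sprod f e * w e) v = f v * ∑ j ∈ G.neighborFinset v, w s(v, j) * f j := by
  rw [vw, Finset.mul_sum]
  refine Finset.sum_congr rfl fun j _ => ?_
  change f v * f j * _ = _
  ring

lemma vw_conj_root :
    vw G (fun e => sprod (rootExt x s) e * w e) x = rootSource G x w ⬝ᵥ s := by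
  rw [vw_sprod_mul, rootExt_root, one_mul, sum_neighborFinset_split G x]
  simp only [SimpleGraph.irrefl, if_false, add_zero, rootExt_coe, dotProduct, rootSource]
  refine Finset.sum_congr rfl fun j _ => ?_
  rw [if_congr (G.adj_comm x j) rfl rfl, Sym2.eq_swap]
  split_ifs <;> simp

lemma vw_conj (hs : ∀ i, 0 < s i) (i : {v : V // v ≠ x}) :
    vw G (fun e => sprod (rootExt x s) e * w e) i =
      s i ^ 2 * potential (redAdj G x w) (rootSource G x w) s i := by
  rw [vw_sprod_mul, rootExt_coe, sum_neighborFinset_split G x]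
  simp only [rootExt_coe, rootExt_root, mul_one, potential, mulVec, dotProduct, redAdj, of_apply,
    rootSource, ite_mul, zero_mul]
  have := (hs i).ne'
  field_simp

lemma tau_conj (hs : ∀ i, 0 < s i) :
    tau G (fun e => sprod (rootExt x s) e * w e) = (∏ i, s i) ^ 2 *
      (diagonal (potential (redAdj G x w) (rootSource G x w) s) - redAdj G x w).det := by
  rw [tau_eq_det G x]
  have h : diagonal (fun i : {v : V // v ≠ x} => vw G (fun e => sprod (rootExt x s) e * w e) i) -
      redAdj G x (fun e => sprod (rootExt x s) e * w e) =
      diagonal s * (diagonal (potential (redAdj G x w) (rootSource G x w) s) - redAdj G x w) *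
        diagonal s := by
    ext i j
    rw [mul_diagonal, diagonal_mul, Matrix.sub_apply, Matrix.sub_apply, diagonal_apply,
      diagonal_apply, vw_conj G x w s hs]
    have h2 : redAdj G x (fun e => sprod (rootExt x s) e * w e) i j =
        s i * s j * redAdj G x w i j := by
      simp only [redAdj, of_apply]
      split_ifs
      · change rootExt x s i * rootExt x s j * _ = _
        rw [rootExt_coe, rootExt_coe]
      · simp
    rw [h2]
    split_ifs with h
    · subst h; ring
    · ring
  rw [h, det_mul, det_mul, det_diagonal]
  ring

lemma sum_redAdj_add_rootSource :
    ∑ i, ∑ j, redAdj G x w i j + 2 * ∑ i, rootSource G x w i = 2 * ∑ e ∈ G.edgeFinset, w e := by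
  rw [← sum_vw, Fintype.sum_eq_add_sum_subtype_ne _ x]
  have h1 : vw G w x = ∑ i, rootSource G x w i := by
    have h := vw_conj_root G x w fun _ => 1
    have h2 : (fun e => sprod (rootExt x fun _ => (1 : ℝ)) e * w e) = w := by
      ext e
      have : sprod (rootExt x fun _ => (1 : ℝ)) e = 1 := by
        induction e with
        | _ i j => change rootExt x _ i * rootExt x _ j = 1; simp [rootExt]
      rw [this, one_mul]
    rw [h2] at h
    simpa [dotProduct] using h
  have h2 : ∀ i : {v : V // v ≠ x}, vw G w i = ∑ j, redAdj G x w i j + rootSource G x w i := by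
    intro i
    rw [vw, sum_neighborFinset_split G x]
    rfl
  simp_rw [h2, Finset.sum_add_distrib, h1]
  ring

variable {w}

lemma redAdj_isSymm : (redAdj G x w).IsSymm :=
  IsSymm.ext fun i j => by simp only [redAdj, of_apply, G.adj_comm, Sym2.eq_swap]

lemma redAdj_nonneg (hw : ∀ e ∈ G.edgeFinset, 0 < w e) (i j) : 0 ≤ redAdj G x w i j := by
  simp only [redAdj, of_apply]
  split_ifs with h
  exacts [(hw _ (by simpa using h)).le, le_rfl]

lemma rootSource_nonneg (hw : ∀ e ∈ G.edgeFinset, 0 < w e) : 0 ≤ rootSource G x w := fun i => by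
  simp only [rootSource]
  split_ifs with h
  exacts [(hw _ (by simpa using h)).le, le_rfl]

lemma leavesEverySet_redAdj (hG : G.Connected) (hw : ∀ e ∈ G.edgeFinset, 0 < w e) :
    LeavesEverySet (redAdj G x w) (rootSource G x w) := by
  rintro S ⟨u, hu⟩
  obtain ⟨p⟩ := hG.preconnected u x
  obtain ⟨d, -, ⟨i, hi, hd1⟩, hd2⟩ := p.exists_boundary_dart (Subtype.val '' S) ⟨u, hu, rfl⟩
    (by rintro ⟨v, -, hv⟩; exact v.2 hv)
  have hadj : G.Adj i d.snd := by rw [hd1]; exact d.adj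
  have hpos : 0 < w s((i : V), d.snd) := hw _ (by simpa using hadj)
  refine ⟨i, hi, ?_⟩
  by_cases h : d.snd = x
  · left
    rw [h] at hadj hpos
    rwa [rootSource, if_pos hadj]
  · right
    refine ⟨⟨d.snd, h⟩, fun hm => hd2 ⟨_, hm, rfl⟩, ?_⟩
    rwa [redAdj, of_apply, if_pos hadj]

end Conjugation

section UnpinnedIntegral
open Matrix
variable (G : SimpleGraph V) [DecidableRel G.Adj] (x : V) (B : Sym2 V → ℝ)

lemma measurable_vw (v : V) : Measurable fun w : Sym2 V → ℝ => vw G w v :=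
  Finset.measurable_sum _ fun _ _ => measurable_pi_apply _

lemma measurable_tau : Measurable fun w : Sym2 V → ℝ => tau G w :=
  Finset.measurable_sum _ fun _ _ => Finset.measurable_prod _ fun _ _ => measurable_pi_apply _

/-- Extension of a weight on the edges of `G` by zero. -/
def edgeExt (W : {e : Sym2 V // e ∈ G.edgeFinset} → ℝ) (e : Sym2 V) : ℝ :=
  if h : e ∈ G.edgeFinset then W ⟨e, h⟩ else 0

lemma measurable_edgeExt : Measurable (edgeExt G) := by
  refine measurable_pi_iff.2 fun e => ?_
  unfold edgeExt
  split_ifs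
  exacts [measurable_pi_apply _, measurable_const]

lemma edgeExt_pos {W : {e : Sym2 V // e ∈ G.edgeFinset} → ℝ} (hW : ∀ e, 0 < W e) :
    ∀ e ∈ G.edgeFinset, 0 < edgeExt G W e := fun e he => by rw [edgeExt, dif_pos he]; exact hW _

lemma edgeExt_mul (c : Sym2 V → ℝ) (W : {e : Sym2 V // e ∈ G.edgeFinset} → ℝ) :
    edgeExt G (fun e => c e * W e) = fun e => c e * edgeExt G W e := by
  ext e
  unfold edgeExt
  split_ifs <;> simp

/-- The joint density of the edge weights and the auxiliary vertex variables. -/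
def jointDensity (w : Sym2 V → ℝ) (s : {v : V // v ≠ x} → ℝ) : ℝ :=
  (∏ e ∈ G.edgeFinset, w e ^ (B e - 1)) * √(tau G w) * exp (-vw G w x) *
    ∏ i : {v : V // v ≠ x}, (2 * s i ^ (-(2 * bwt G x B i + 1)) * exp (-(vw G w i / s i ^ 2)))

lemma measurable_jointDensity :
    Measurable fun p : ({e : Sym2 V // e ∈ G.edgeFinset} → ℝ) × ({v : V // v ≠ x} → ℝ) =>
      jointDensity G x B (edgeExt G p.1) p.2 := by
  have h1 := measurable_edgeExt G
  have h2 := measurable_tau G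
  have h3 := measurable_vw G
  unfold jointDensity
  have h4 : ∀ e, Measurable fun p : ({e : Sym2 V // e ∈ G.edgeFinset} → ℝ) × ({v : V // v ≠ x} → ℝ) =>
      edgeExt G p.1 e := fun e => (measurable_pi_apply e).comp (h1.comp measurable_fst)
  have h5 : ∀ v, Measurable fun p : ({e : Sym2 V // e ∈ G.edgeFinset} → ℝ) × ({v : V // v ≠ x} → ℝ) =>
      vw G (edgeExt G p.1) v := fun v => (h3 v).comp (h1.comp measurable_fst)
  have h6 : Measurable fun p : ({e : Sym2 V // e ∈ G.edgeFinset} → ℝ) × ({v : V // v ≠ x} → ℝ) =>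
      tau G (edgeExt G p.1) := h2.comp (h1.comp measurable_fst)
  have h7 : ∀ i, Measurable fun p : ({e : Sym2 V // e ∈ G.edgeFinset} → ℝ) × ({v : V // v ≠ x} → ℝ) =>
      p.2 i := fun i => (measurable_pi_apply i).comp measurable_snd
  refine Measurable.mul (Measurable.mul (Measurable.mul ?_ h6.sqrt) (h5 x).neg.exp) ?_
  · exact Finset.measurable_prod _ fun e _ => (h4 e).pow_const _
  · exact Finset.measurable_prod _ fun i _ => (((h7 i).pow_const _).const_mul _).mul
      ((h5 i).div ((h7 i).pow_const 2)).neg.exp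

lemma bwt_coe (i : {v : V // v ≠ x}) : bwt G x B i = (vw G B i + 1) / 2 := by
  simp [bwt, i.2]

lemma jointDensity_conj {w : Sym2 V → ℝ} (hw : ∀ e ∈ G.edgeFinset, 0 < w e)
    {s : {v : V // v ≠ x} → ℝ} (hs : ∀ i, 0 < s i) :
    (∏ e ∈ G.edgeFinset, sprod (rootExt x s) e) *
        jointDensity G x B (fun e => sprod (rootExt x s) e * w e) s =
      (2 ^ Fintype.card {v : V // v ≠ x} * ∏ e ∈ G.edgeFinset, w e ^ (B e - 1)) *
        ((∏ i, (s i)⁻¹) *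
          √(diagonal (potential (redAdj G x w) (rootSource G x w) s) - redAdj G x w).det *
          exp (-(∑ i, potential (redAdj G x w) (rootSource G x w) s i +
            rootSource G x w ⬝ᵥ s))) := by
  have hr := rootExt_pos x hs
  set F := potential (redAdj G x w) (rootSource G x w) s with hF
  have hp : 0 < ∏ i, s i := Finset.prod_pos fun i _ => hs i
  have h1 : (∏ e ∈ G.edgeFinset, sprod (rootExt x s) e) *
      ∏ e ∈ G.edgeFinset, (sprod (rootExt x s) e * w e) ^ (B e - 1) =
      (∏ i : {v : V // v ≠ x}, s i ^ vw G B i) * ∏ e ∈ G.edgeFinset, w e ^ (B e - 1) := by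
    have h2 := prod_sprod_rpow G B hr
    rw [Fintype.prod_eq_mul_prod_subtype_ne _ x, rootExt_root, Real.one_rpow, one_mul] at h2
    simp_rw [rootExt_coe] at h2
    rw [← h2, ← Finset.prod_mul_distrib, ← Finset.prod_mul_distrib]
    refine Finset.prod_congr rfl fun e he => ?_
    have := sprod_pos hr e
    rw [Real.mul_rpow this.le (hw e he).le, Real.rpow_sub_one this.ne']
    field_simp
  have h3 : ∀ i : {v : V // v ≠ x}, s i ^ vw G B i * s i *
      (2 * s i ^ (-(2 * bwt G x B i + 1)) * exp (-(s i ^ 2 * F i / s i ^ 2))) =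
      2 * ((s i)⁻¹ * exp (-F i)) := by
    intro i
    have hi := hs i
    rw [mul_div_cancel_left₀ _ (by positivity), bwt_coe,
      show -(2 * ((vw G B i + 1) / 2) + 1) = -vw G B i - 1 - 1 by ring,
      Real.rpow_sub_one hi.ne', Real.rpow_sub_one hi.ne', Real.rpow_neg hi.le]
    have := Real.rpow_pos_of_pos hi (vw G B i)
    field_simp
  simp only [jointDensity]
  rw [tau_conj G x w s hs, vw_conj_root, Real.sqrt_mul (sq_nonneg _), Real.sqrt_sq hp.le]
  simp_rw [vw_conj G x w s hs, ← hF]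
  calc _ = ((∏ e ∈ G.edgeFinset, sprod (rootExt x s) e) *
        ∏ e ∈ G.edgeFinset, (sprod (rootExt x s) e * w e) ^ (B e - 1)) * (∏ i, s i) *
        (∏ i : {v : V // v ≠ x}, (2 * s i ^ (-(2 * bwt G x B i + 1)) *
          exp (-(s i ^ 2 * F i / s i ^ 2)))) * √(diagonal F - redAdj G x w).det *
        exp (-(rootSource G x w ⬝ᵥ s)) := by ring
    _ = (∏ i : {v : V // v ≠ x}, (s i ^ vw G B i * s i *
        (2 * s i ^ (-(2 * bwt G x B i + 1)) * exp (-(s i ^ 2 * F i / s i ^ 2))))) *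
        (∏ e ∈ G.edgeFinset, w e ^ (B e - 1)) * √(diagonal F - redAdj G x w).det *
        exp (-(rootSource G x w ⬝ᵥ s)) := by
      rw [h1]; simp_rw [Finset.prod_mul_distrib]; ring
    _ = _ := by
      simp_rw [h3, Finset.prod_mul_distrib, Finset.prod_const, Finset.card_univ, ← Real.exp_sum,
        Finset.sum_neg_distrib]
      rw [neg_add, Real.exp_add]
      ring

end UnpinnedIntegral

section UnpinnedNormalization
open Matrix
variable (G : SimpleGraph V) [DecidableRel G.Adj] (x : V) {B : Sym2 V → ℝ}

lemma lintegral_jointDensity_conj (s : {v : V // v ≠ x} → ℝ) (hs : ∀ i, 0 < s i) :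
    ∫⁻ W in posOrthant {e : Sym2 V // e ∈ G.edgeFinset},
        ENNReal.ofReal (jointDensity G x B (edgeExt G W) s) =
      ∫⁻ W in posOrthant {e : Sym2 V // e ∈ G.edgeFinset},
        ENNReal.ofReal (2 ^ Fintype.card {v : V // v ≠ x} *
          ∏ e ∈ G.edgeFinset, edgeExt G W e ^ (B e - 1)) *
        ENNReal.ofReal ((∏ i, (s i)⁻¹) *
          √(diagonal (potential (redAdj G x (edgeExt G W)) (rootSource G x (edgeExt G W)) s) -
            redAdj G x (edgeExt G W)).det *
          exp (-(∑ i, potential (redAdj G x (edgeExt G W)) (rootSource G x (edgeExt G W)) s i +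
            rootSource G x (edgeExt G W) ⬝ᵥ s))) := by
  have hc : ∀ e : {e : Sym2 V // e ∈ G.edgeFinset}, 0 < sprod (rootExt x s) e :=
    fun e => sprod_pos (rootExt_pos x hs) e
  have hm : Measurable fun W => ENNReal.ofReal (jointDensity G x B (edgeExt G W) s) :=
    ((measurable_jointDensity G x B).comp
      (measurable_id.prodMk measurable_const)).ennreal_ofReal
  rw [lintegral_posOrthant_scale hc hm, ← lintegral_const_mul' _ _ ENNReal.ofReal_ne_top]
  refine setLIntegral_congr_fun (measurableSet_posOrthant _) fun W hW => ?_
  have hw := edgeExt_pos G hW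
  rw [← ENNReal.ofReal_mul (Finset.prod_nonneg fun e _ => (hc e).le), ← ENNReal.ofReal_mul,
    ← jointDensity_conj G x B hw hs, edgeExt_mul, Finset.prod_coe_sort G.edgeFinset]
  exact mul_nonneg (by positivity) (Finset.prod_nonneg fun e he =>
      (Real.rpow_pos_of_pos (hw e he) _).le)

lemma measurable_conjDensity (f : (Sym2 V → ℝ) → ℝ≥0∞) (hf : Measurable f) :
    Measurable fun p : ({v : V // v ≠ x} → ℝ) × ({e : Sym2 V // e ∈ G.edgeFinset} → ℝ) =>
      f (edgeExt G p.2) *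
        ENNReal.ofReal ((∏ i, (p.1 i)⁻¹) *
          √(diagonal (potential (redAdj G x (edgeExt G p.2)) (rootSource G x (edgeExt G p.2)) p.1) -
            redAdj G x (edgeExt G p.2)).det *
          exp (-(∑ i, potential (redAdj G x (edgeExt G p.2)) (rootSource G x (edgeExt G p.2)) p.1 i +
            rootSource G x (edgeExt G p.2) ⬝ᵥ p.1))) := by
  set X := ({v : V // v ≠ x} → ℝ) × ({e : Sym2 V // e ∈ G.edgeFinset} → ℝ)
  have h1 : Measurable fun p : X => edgeExt G p.2 := (measurable_edgeExt G).comp measurable_snd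
  have h2 : ∀ i, Measurable fun p : X => p.1 i :=
    fun i => (measurable_pi_apply i).comp measurable_fst
  have h3 : ∀ e, Measurable fun p : X => edgeExt G p.2 e := fun e => (measurable_pi_apply e).comp h1
  have hW : ∀ i j, Measurable fun p : X => redAdj G x (edgeExt G p.2) i j := fun i j => by
    simp only [redAdj, of_apply]
    split_ifs
    exacts [h3 _, measurable_const]
  have hη : ∀ i, Measurable fun p : X => rootSource G x (edgeExt G p.2) i := fun i => by
    simp only [rootSource]
    split_ifs
    exacts [h3 _, measurable_const]
  have hF : ∀ i, Measurable fun p : X =>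
      potential (redAdj G x (edgeExt G p.2)) (rootSource G x (edgeExt G p.2)) p.1 i := fun i =>
    ((Finset.measurable_sum _ fun j _ => (hW i j).mul (h2 j)).add (hη i)).div (h2 i)
  refine (hf.comp h1).mul (Measurable.ennreal_ofReal ((Measurable.mul ?_ (Measurable.sqrt ?_)).mul
    (Measurable.exp (Measurable.neg (Measurable.add ?_ ?_)))))
  · exact Finset.measurable_prod _ fun i _ => (h2 i).inv
  · simp_rw [det_apply]
    refine Finset.measurable_sum _ fun σ _ => Measurable.const_smul
      (Finset.measurable_prod _ fun i _ => ?_) _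
    simp only [Matrix.sub_apply, diagonal_apply]
    refine Measurable.sub ?_ (hW _ _)
    split_ifs
    exacts [hF _, measurable_const]
  · exact Finset.measurable_sum _ fun i _ => hF i
  · exact Finset.measurable_sum _ fun i _ => (hη i).mul (h2 i)

lemma bwt_pos_of_ne {G : SimpleGraph V} [DecidableRel G.Adj]
    (hG : ∀ v, (G.neighborFinset v).Nonempty) (hB : ∀ e ∈ G.edgeFinset, 0 < B e) (v : V) : 0 < bwt G x B v := by
  have := vw_pos hB (hG v)
  unfold bwt
  split_ifs <;> linarith

/-- Normalization of the magic formula before pinning an edge. -/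
theorem lintegral_unpinned (hG : G.Connected) (hne : ∀ v, (G.neighborFinset v).Nonempty)
    (hB : ∀ e ∈ G.edgeFinset, 0 < B e) :
    (∫⁻ W in posOrthant {e : Sym2 V // e ∈ G.edgeFinset},
        ENNReal.ofReal ((∏ e ∈ G.edgeFinset, edgeExt G W e ^ (B e - 1)) * √(tau G (edgeExt G W)) *
          exp (-vw G (edgeExt G W) x) *
          ∏ i : {v : V // v ≠ x}, vw G (edgeExt G W) i ^ (-bwt G x B i))) *
      ENNReal.ofReal (∏ i : {v : V // v ≠ x}, Real.Gamma (bwt G x B i)) =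
    ENNReal.ofReal ((2 * √π) ^ Fintype.card {v : V // v ≠ x} *
      ∏ e ∈ G.edgeFinset, (Real.Gamma (B e) * 2 ^ (-B e))) := by
  have hb := fun v => bwt_pos_of_ne x hne hB v
  have hpU := measurableSet_posOrthant {v : V // v ≠ x}
  have hpE := measurableSet_posOrthant {e : Sym2 V // e ∈ G.edgeFinset}
  have hvertex : ∀ W ∈ posOrthant {e : Sym2 V // e ∈ G.edgeFinset},
      ENNReal.ofReal ((∏ e ∈ G.edgeFinset, edgeExt G W e ^ (B e - 1)) * √(tau G (edgeExt G W)) *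
          exp (-vw G (edgeExt G W) x) *
          ∏ i : {v : V // v ≠ x}, vw G (edgeExt G W) i ^ (-bwt G x B i)) *
      ENNReal.ofReal (∏ i : {v : V // v ≠ x}, Real.Gamma (bwt G x B i)) =
      ∫⁻ s in posOrthant {v : V // v ≠ x}, ENNReal.ofReal (jointDensity G x B (edgeExt G W) s) := by
    intro W hW
    have hw := edgeExt_pos G hW
    have hv := fun v => vw_pos hw (hne v)
    have hA : 0 ≤ (∏ e ∈ G.edgeFinset, edgeExt G W e ^ (B e - 1)) * √(tau G (edgeExt G W)) *
          exp (-vw G (edgeExt G W) x) :=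
      mul_nonneg (mul_nonneg (Finset.prod_nonneg fun e he => (Real.rpow_pos_of_pos (hw e he) _).le)
        (sqrt_nonneg _)) (exp_pos _).le
    have hvb : ∀ i : {v : V // v ≠ x}, 0 ≤ vw G (edgeExt G W) i ^ (-bwt G x B i) :=
      fun i => (Real.rpow_pos_of_pos (hv i) _).le
    have hΓ : ∀ i : {v : V // v ≠ x}, 0 ≤ Real.Gamma (bwt G x B i) :=
      fun i => (Real.Gamma_pos_of_pos (hb i)).le
    have hg : ∏ i : {v : V // v ≠ x}, ∫⁻ y in Set.Ioi (0 : ℝ), ENNReal.ofReal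
        (2 * y ^ (-(2 * bwt G x B i + 1)) * exp (-(vw G (edgeExt G W) i / y ^ 2))) =
        ENNReal.ofReal (∏ i : {v : V // v ≠ x},
          (Real.Gamma (bwt G x B i) * vw G (edgeExt G W) i ^ (-bwt G x B i))) := by
      rw [ENNReal.ofReal_prod_of_nonneg fun i _ => mul_nonneg (hΓ i) (hvb i)]
      exact Finset.prod_congr rfl fun i _ => lintegral_inv_sq_gamma (hb i) (hv i)
    rw [← lintegral_posOrthant_prod _ fun i => by fun_prop] at hg
    rw [← ENNReal.ofReal_mul (mul_nonneg hA (Finset.prod_nonneg fun i _ => hvb i)), mul_assoc,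
      mul_comm (∏ i : {v : V // v ≠ x}, _ ^ _),
      ← Finset.prod_mul_distrib, ENNReal.ofReal_mul hA, ← hg,
      ← lintegral_const_mul' _ _ ENNReal.ofReal_ne_top]
    refine setLIntegral_congr_fun hpU fun s hs => ?_
    rw [jointDensity, ENNReal.ofReal_mul hA, ENNReal.ofReal_prod_of_nonneg fun i _ => ?_]
    have : 0 < s i := hs i
    positivity
  have hedge : ∀ W ∈ posOrthant {e : Sym2 V // e ∈ G.edgeFinset},
      ∫⁻ s in posOrthant {v : V // v ≠ x},
        ENNReal.ofReal (2 ^ Fintype.card {v : V // v ≠ x} *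
          ∏ e ∈ G.edgeFinset, edgeExt G W e ^ (B e - 1)) *
        ENNReal.ofReal ((∏ i, (s i)⁻¹) *
          √(diagonal (potential (redAdj G x (edgeExt G W)) (rootSource G x (edgeExt G W)) s) -
            redAdj G x (edgeExt G W)).det *
          exp (-(∑ i, potential (redAdj G x (edgeExt G W)) (rootSource G x (edgeExt G W)) s i +
            rootSource G x (edgeExt G W) ⬝ᵥ s))) =
      ENNReal.ofReal ((2 * √π) ^ Fintype.card {v : V // v ≠ x}) *
        ∏ e : {e : Sym2 V // e ∈ G.edgeFinset},
          ENNReal.ofReal (W e ^ (B e - 1) * exp (-(2 * W e))) := by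
    intro W hW
    have hw := edgeExt_pos G hW
    have hP : 0 ≤ ∏ e ∈ G.edgeFinset, edgeExt G W e ^ (B e - 1) :=
      Finset.prod_nonneg fun e he => (Real.rpow_pos_of_pos (hw e he) _).le
    rw [lintegral_const_mul' _ _ ENNReal.ofReal_ne_top, posOrthant,
      lintegral_potential (redAdj_isSymm G x) (redAdj_nonneg G x hw) (rootSource_nonneg G x hw)
        (leavesEverySet_redAdj G x hG hw), sum_redAdj_add_rootSource,
      ← ENNReal.ofReal_mul (by positivity), ← ENNReal.ofReal_prod_of_nonneg,
      ← ENNReal.ofReal_mul (by positivity)]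
    · congr 1
      rw [Finset.prod_mul_distrib, ← Real.exp_sum, mul_pow, Finset.mul_sum,
        ← Finset.sum_neg_distrib, ← Finset.prod_coe_sort, ← Finset.sum_coe_sort]
      have : ∀ e : {e : Sym2 V // e ∈ G.edgeFinset}, edgeExt G W e = W e := fun e => by
        rw [edgeExt, dif_pos e.2]
      simp_rw [this]
      ring
    · intro e _
      exact mul_nonneg (Real.rpow_pos_of_pos (hW e) _).le (exp_pos _).le
  rw [← lintegral_mul_const' _ _ ENNReal.ofReal_ne_top, setLIntegral_congr_fun hpE hvertex,
    lintegral_lintegral_swap, setLIntegral_congr_fun hpU fun s hs =>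
      lintegral_jointDensity_conj G x s hs, lintegral_lintegral_swap,
    setLIntegral_congr_fun hpE hedge, lintegral_const_mul' _ _ ENNReal.ofReal_ne_top,
    lintegral_posOrthant_prod (fun (e : {e : Sym2 V // e ∈ G.edgeFinset}) y =>
      ENNReal.ofReal (y ^ (B e - 1) * exp (-(2 * y)))) fun e => by fun_prop]
  · rw [ENNReal.ofReal_mul (by positivity), ← Finset.prod_coe_sort G.edgeFinset,
      ENNReal.ofReal_prod_of_nonneg]
    · congr 1
      exact Finset.prod_congr rfl fun (e : {e : Sym2 V // e ∈ G.edgeFinset}) _ =>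
        lintegral_gamma (hB e e.2) two_pos
    · rintro ⟨e, he⟩ _
      have := Real.Gamma_pos_of_pos (hB e he)
      positivity
  · refine (measurable_conjDensity G x (fun w => ENNReal.ofReal
      (2 ^ Fintype.card {v : V // v ≠ x} * ∏ e ∈ G.edgeFinset, w e ^ (B e - 1))) ?_).aemeasurable
    fun_prop
  · exact (measurable_jointDensity G x B).ennreal_ofReal.aemeasurable

end UnpinnedNormalization

section Pinning

lemma lintegral_posOrthant_eq_pinned {ι κ : Type*} [Fintype ι] [Fintype κ] (e : Unit ⊕ ι ≃ κ)
    {g : (κ → ℝ) → ℝ≥0∞} (hg : Measurable g) :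
    ∫⁻ w in posOrthant κ, g w = ∫⁻ u in posOrthant ι, ∫⁻ r in Set.Ioi (0 : ℝ),
      ENNReal.ofReal (r ^ Fintype.card ι) *
        g (fun k => r * (Sum.elim (fun _ => 1) u : Unit ⊕ ι → ℝ) (e.symm k)) := by
  have hκ := measurableSet_posOrthant κ
  have hι := measurableSet_posOrthant ι
  have hre : Measurable fun y : Unit ⊕ ι → ℝ => y ∘ e.symm :=
    measurable_pi_iff.2 fun k => measurable_pi_apply _
  have hel : Measurable fun p : (ι → ℝ) × ℝ => (Sum.elim (fun _ => p.2) p.1 : Unit ⊕ ι → ℝ) := by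
    refine measurable_pi_iff.2 ?_
    rintro (_ | i)
    exacts [measurable_snd, (measurable_pi_apply i).comp measurable_fst]
  have hel1 : Measurable fun p : ℝ × (ι → ℝ) =>
      fun k => p.1 * (Sum.elim (fun _ => 1) p.2 : Unit ⊕ ι → ℝ) (e.symm k) := by
    refine measurable_pi_iff.2 fun k => measurable_fst.mul ?_
    rcases e.symm k with _ | i
    exacts [measurable_const, (measurable_pi_apply i).comp measurable_snd]
  have hmem : ∀ (b : ℝ) (y : ι → ℝ), (Sum.elim (fun _ => b) y : Unit ⊕ ι → ℝ) ∘ e.symm ∈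
      posOrthant κ ↔ b ∈ Set.Ioi 0 ∧ y ∈ posOrthant ι := by
    intro b y
    simp only [posOrthant, Set.mem_ofPred_eq, Function.comp, Set.mem_Ioi]
    rw [e.symm.surjective.forall
      (p := fun k => 0 < (Sum.elim (fun _ => b) y : Unit ⊕ ι → ℝ) k) |>.symm]
    simp
  rw [← lintegral_indicator hκ, lintegral_pi_reindex e,
    lintegral_pi_unit_sum (f := fun y => (posOrthant κ).indicator g (y ∘ e.symm))
      ((hg.indicator hκ).comp hre), lintegral_lintegral_swap
      (f := fun y b => (posOrthant κ).indicator g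
        ((Sum.elim (fun _ => b) y : Unit ⊕ ι → ℝ) ∘ e.symm))
      ((hg.indicator hκ).comp (hre.comp hel)).aemeasurable,
    lintegral_lintegral_swap (μ := volume.restrict (posOrthant ι)),
    ← lintegral_indicator measurableSet_Ioi]
  · refine lintegral_congr fun b => ?_
    by_cases hb : b ∈ Set.Ioi (0 : ℝ)
    · rw [Set.indicator_of_mem hb, lintegral_const_mul' _ _ ENNReal.ofReal_ne_top]
      have hsc := lintegral_posOrthant_scale (c := fun _ : ι => b) (fun _ => hb)
        (f := fun y => g ((Sum.elim (fun _ => b) y : Unit ⊕ ι → ℝ) ∘ e.symm))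
        (hg.comp (hre.comp (hel.comp (measurable_id.prodMk measurable_const))))
      rw [Finset.prod_const, Finset.card_univ] at hsc
      rw [show (fun y : ι → ℝ => (posOrthant κ).indicator g
        ((Sum.elim (fun _ => b) y : Unit ⊕ ι → ℝ) ∘ e.symm)) = (posOrthant ι).indicator
          fun y => g ((Sum.elim (fun _ => b) y : Unit ⊕ ι → ℝ) ∘ e.symm) from ?_,
        lintegral_indicator hι, hsc]
      · congr 1
        refine lintegral_congr fun y => ?_
        congr 1
        ext k
        simp only [Function.comp]
        rcases e.symm k <;> simp
      · ext y
        by_cases hy : y ∈ posOrthant ι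
        · rw [Set.indicator_of_mem hy, Set.indicator_of_mem ((hmem b y).2 ⟨hb, hy⟩)]
        · rw [Set.indicator_of_notMem hy, Set.indicator_of_notMem fun h => hy ((hmem b y).1 h).2]
    · rw [Set.indicator_of_notMem hb]
      refine (lintegral_congr fun y => ?_).trans lintegral_zero
      exact Set.indicator_of_notMem (fun h => hb ((hmem b y).1 h).1) _
  · exact ((measurable_snd.pow_const _).ennreal_ofReal.mul
      (hg.comp (hel1.comp measurable_swap))).aemeasurable

variable (G : SimpleGraph V) [DecidableRel G.Adj]

lemma vw_smul (r : ℝ) (w : Sym2 V → ℝ) (v : V) : vw G (fun e => r * w e) v = r * vw G w v := by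
  simp only [vw, Finset.mul_sum]

lemma tau_smul (r : ℝ) (w : Sym2 V → ℝ) (x : V) :
    tau G (fun e => r * w e) = r ^ Fintype.card {v : V // v ≠ x} * tau G w := by
  rw [tau_eq_det G x, tau_eq_det G x, ← Matrix.det_smul]
  congr 1
  ext i j
  simp only [Matrix.sub_apply, Matrix.smul_apply, Matrix.diagonal_apply, redAdj, Matrix.of_apply,
    vw_smul, smul_eq_mul]
  split_ifs <;> ring

/-- The unnormalized density of the magic formula. -/
def magicWeight (x : V) (B w : Sym2 V → ℝ) : ℝ :=
  (∏ e ∈ G.edgeFinset, w e ^ (B e - 1)) * √(tau G w) * ∏ v, vw G w v ^ (-bwt G x B v)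

lemma magicDensity_eq (hne : ∀ v, (G.neighborFinset v).Nonempty) (x : V) (B : Sym2 V → ℝ)
    {w : Sym2 V → ℝ} (hw : ∀ e ∈ G.edgeFinset, 0 < w e) :
    magicDensity G x B w = (Znorm G x B)⁻¹ * magicWeight G x B w := by
  have hv := fun v => vw_pos hw (hne v)
  have h : (∏ v, vw G w v ^ (-bwt G x B v)) * ∏ v, vw G w v ^ ((vw G B v + 1) / 2) =
      vw G w x ^ ((1 : ℝ) / 2) := by
    rw [← Finset.prod_mul_distrib, Finset.prod_eq_single x]
    · rw [← Real.rpow_add (hv x), bwt, if_pos rfl]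
      congr 1
      ring
    · intro v _ hvx
      rw [← Real.rpow_add (hv v), bwt, if_neg hvx]
      convert Real.rpow_zero _ using 2
      ring
    · simp
  have hp : (0 : ℝ) < ∏ v, vw G w v ^ ((vw G B v + 1) / 2) :=
    Finset.prod_pos fun v _ => Real.rpow_pos_of_pos (hv v) _
  rw [magicDensity, magicWeight, ← h]
  field_simp

/-- The value of the unpinned density along a ray. -/
lemma unpinned_smul (hne : ∀ v, (G.neighborFinset v).Nonempty) (x : V) (B : Sym2 V → ℝ)
    {w : Sym2 V → ℝ} (hw : ∀ e ∈ G.edgeFinset, 0 < w e) {r : ℝ} (hr : 0 < r) :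
    (∏ e ∈ G.edgeFinset, (r * w e) ^ (B e - 1)) * √(tau G fun e => r * w e) *
        exp (-vw G (fun e => r * w e) x) *
        (∏ i : {v : V // v ≠ x}, vw G (fun e => r * w e) i ^ (-bwt G x B i)) *
        r ^ G.edgeFinset.card =
      magicWeight G x B w * vw G w x ^ bwt G x B x *
        (r * (r ^ (bwt G x B x - 1) * exp (-(vw G w x * r)))) := by
  have hv := fun v => vw_pos hw (hne v)
  set m : ℝ := (Fintype.card {v : V // v ≠ x} : ℝ) with hm
  have hsum : ∑ e ∈ G.edgeFinset, (B e - 1) + m / 2 + ∑ i : {v : V // v ≠ x}, -bwt G x B i +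
      G.edgeFinset.card = 1 + (bwt G x B x - 1) := by
    have h := sum_vw G B
    rw [Fintype.sum_eq_add_sum_subtype_ne _ x] at h
    simp_rw [bwt_coe, Finset.sum_neg_distrib, ← Finset.sum_div, Finset.sum_add_distrib,
      Finset.sum_sub_distrib, bwt, if_pos]
    simp only [Finset.sum_const, Finset.card_univ, nsmul_eq_mul, mul_one, ← hm]
    linarith
  have h1 : ∏ e ∈ G.edgeFinset, (r * w e) ^ (B e - 1) =
      r ^ (∑ e ∈ G.edgeFinset, (B e - 1)) * ∏ e ∈ G.edgeFinset, w e ^ (B e - 1) := by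
    rw [Real.rpow_sum_of_pos hr, ← Finset.prod_mul_distrib]
    exact Finset.prod_congr rfl fun e he => Real.mul_rpow hr.le (hw e he).le
  have h2 : √(tau G fun e => r * w e) = r ^ (m / 2) * √(tau G w) := by
    rw [tau_smul G r w x, Real.sqrt_mul (by positivity), Real.sqrt_eq_rpow, ← Real.rpow_natCast,
      ← Real.rpow_mul hr.le, ← hm, mul_one_div]
  have h3 : ∏ i : {v : V // v ≠ x}, vw G (fun e => r * w e) i ^ (-bwt G x B i) =
      r ^ (∑ i : {v : V // v ≠ x}, -bwt G x B i) *
        ∏ i : {v : V // v ≠ x}, vw G w i ^ (-bwt G x B i) := by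
    rw [Real.rpow_sum_of_pos hr, ← Finset.prod_mul_distrib]
    refine Finset.prod_congr rfl fun i _ => ?_
    rw [vw_smul, Real.mul_rpow hr.le (hv i).le]
  have h4 : vw G w x ^ (-bwt G x B x) * vw G w x ^ bwt G x B x = 1 := by
    rw [← Real.rpow_add (hv x), neg_add_cancel, Real.rpow_zero]
  have h5 : r * r ^ (bwt G x B x - 1) = r ^ (∑ e ∈ G.edgeFinset, (B e - 1)) * r ^ (m / 2) *
      r ^ (∑ i : {v : V // v ≠ x}, -bwt G x B i) * r ^ G.edgeFinset.card := by
    rw [← Real.rpow_natCast, ← Real.rpow_add hr, ← Real.rpow_add hr, ← Real.rpow_add hr, hsum,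
      Real.rpow_add hr, Real.rpow_one]
  rw [h1, h2, h3, magicWeight, Fintype.prod_eq_mul_prod_subtype_ne _ x, vw_smul, ← mul_assoc r, h5,
    mul_comm (vw G w x) r]
  calc _ = (∏ e ∈ G.edgeFinset, w e ^ (B e - 1)) * √(tau G w) *
        (1 * ∏ i : {v : V // v ≠ x}, vw G w i ^ (-bwt G x B i)) *
        (r ^ (∑ e ∈ G.edgeFinset, (B e - 1)) * r ^ (m / 2) *
          r ^ (∑ i : {v : V // v ≠ x}, -bwt G x B i) * r ^ G.edgeFinset.card *
        exp (-(r * vw G w x))) := by ring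
    _ = _ := by rw [← h4]; ring

variable {G} {e0 : Sym2 V}

/-- Splitting off the reference edge. -/
def pinEquiv (he0 : e0 ∈ G.edgeFinset) : Unit ⊕ Epin G e0 ≃ {e : Sym2 V // e ∈ G.edgeFinset} where
  toFun := Sum.elim (fun _ => ⟨e0, he0⟩) fun u => ⟨u, u.2.1⟩
  invFun e := if h : (e : Sym2 V) = e0 then Sum.inl () else Sum.inr ⟨e, e.2, h⟩
  left_inv := by
    rintro (_ | ⟨e, he, h⟩)
    · simp
    · simp [h]
  right_inv := by
    rintro ⟨e, he⟩
    by_cases h : e = e0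
    · subst h; simp
    · simp [h]

lemma edgeExt_pinEquiv (he0 : e0 ∈ G.edgeFinset) (r : ℝ) (u : Epin G e0 → ℝ) :
    edgeExt G (fun k => r * (Sum.elim (fun _ => 1) u : Unit ⊕ Epin G e0 → ℝ)
      ((pinEquiv he0).symm k)) = fun e => r * pinExt G e0 u e := by
  ext e
  unfold edgeExt pinExt
  by_cases h : e = e0
  · subst h
    simp only [dif_pos he0, if_true]
    simp [pinEquiv]
  · by_cases he : e ∈ G.edgeFinset
    · simp only [dif_pos he, if_neg h, dif_pos (And.intro he h)]
      simp [pinEquiv, h]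
    · simp only [dif_neg he, if_neg h, dif_neg fun h' : e ∈ G.edgeFinset ∧ e ≠ e0 => he h'.1,
        mul_zero]

lemma card_Epin_add_one (he0 : e0 ∈ G.edgeFinset) :
    Fintype.card (Epin G e0) + 1 = G.edgeFinset.card := by
  have := Fintype.card_congr (pinEquiv he0)
  rw [Fintype.card_sum, Fintype.card_unit, Fintype.card_coe] at this
  omega

lemma pinExt_pos_iff (u : Epin G e0 → ℝ) :
    (∀ e ∈ G.edgeFinset, 0 < pinExt G e0 u e) ↔ u ∈ posOrthant (Epin G e0) := by
  unfold pinExt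
  constructor
  · rintro h ⟨e, he, hne⟩
    simpa only [if_neg hne, dif_pos (And.intro he hne)] using h e he
  · intro h e he
    split_ifs with h1 h2
    exacts [one_pos, h _, (h2 ⟨he, h1⟩).elim]

lemma measurable_pinExt : Measurable (pinExt G e0) := by
  refine measurable_pi_iff.2 fun e => ?_
  unfold pinExt
  split_ifs
  exacts [measurable_const, measurable_pi_apply _, measurable_const]

lemma measurable_magicWeight (x : V) (B : Sym2 V → ℝ) : Measurable (magicWeight G x B) := by
  unfold magicWeight
  refine Measurable.mul (Measurable.mul ?_ (measurable_tau G).sqrt) ?_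
  · exact Finset.measurable_prod _ fun e _ => (measurable_pi_apply e).pow_const _
  · exact Finset.measurable_prod _ fun v _ => (measurable_vw G v).pow_const _

lemma magicWeight_nonneg (hne : ∀ v, (G.neighborFinset v).Nonempty) (x : V) (B : Sym2 V → ℝ)
    {w : Sym2 V → ℝ} (hw : ∀ e ∈ G.edgeFinset, 0 < w e) : 0 ≤ magicWeight G x B w :=
  mul_nonneg (mul_nonneg (Finset.prod_nonneg fun e he => (Real.rpow_pos_of_pos (hw e he) _).le)
    (Real.sqrt_nonneg _))
    (Finset.prod_nonneg fun v _ => (Real.rpow_pos_of_pos (vw_pos hw (hne v)) _).le)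

lemma Znorm_mul_prod_Gamma (x : V) (B : Sym2 V → ℝ) (hb : ∀ v, 0 < bwt G x B v) :
    Znorm G x B * ∏ v, Real.Gamma (bwt G x B v) =
      (2 * √π) ^ Fintype.card {v : V // v ≠ x} *
        ∏ e ∈ G.edgeFinset, (Real.Gamma (B e) * 2 ^ (-B e)) := by
  have hcard : (Fintype.card V : ℝ) - 1 = (Fintype.card {v : V // v ≠ x} : ℝ) := by
    have h := Fintype.sum_eq_add_sum_subtype_ne (fun _ : V => (1 : ℝ)) x
    simp only [Finset.sum_const, Finset.card_univ, nsmul_eq_mul, mul_one] at h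
    linarith
  have hp : 0 < ∏ v, Real.Gamma (bwt G x B v) :=
    Finset.prod_pos fun v _ => Real.Gamma_pos_of_pos (hb v)
  have h2 : (2 : ℝ) ^ ((1 : ℝ) - (Fintype.card V : ℝ) + ∑ e ∈ G.edgeFinset, B e) =
      (2 ^ Fintype.card {v : V // v ≠ x} * ∏ e ∈ G.edgeFinset, (2 : ℝ) ^ (-B e))⁻¹ := by
    rw [← Real.rpow_sum_of_pos two_pos, ← Real.rpow_natCast, ← Real.rpow_add two_pos,
      ← Real.rpow_neg two_pos.le, ← hcard, Finset.sum_neg_distrib]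
    congr 1
    ring
  rw [Znorm, h2, hcard, mul_pow, Finset.prod_mul_distrib, Real.sqrt_eq_rpow π, ← Real.rpow_natCast
    (π ^ _), ← Real.rpow_mul pi_pos.le, one_div_mul_eq_div, div_inv_eq_mul]
  field_simp

/-- Normalization of the magic formula. -/
theorem lintegral_magicWeight (hG : G.Connected) (hne : ∀ v, (G.neighborFinset v).Nonempty)
    (he0 : e0 ∈ G.edgeFinset) (x : V) {B : Sym2 V → ℝ} (hB : ∀ e ∈ G.edgeFinset, 0 < B e) :
    ∫⁻ u in posOrthant (Epin G e0), ENNReal.ofReal (magicWeight G x B (pinExt G e0 u)) =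
      ENNReal.ofReal (Znorm G x B) := by
  have hb := fun v => bwt_pos_of_ne x hne hB v
  have hΓ := fun v => Real.Gamma_pos_of_pos (hb v)
  have h := lintegral_unpinned G x hG hne hB
  have hmeas : Measurable fun W : {e : Sym2 V // e ∈ G.edgeFinset} → ℝ =>
      ENNReal.ofReal ((∏ e ∈ G.edgeFinset, edgeExt G W e ^ (B e - 1)) * √(tau G (edgeExt G W)) *
          exp (-vw G (edgeExt G W) x) *
          ∏ i : {v : V // v ≠ x}, vw G (edgeExt G W) i ^ (-bwt G x B i)) := by
    have h1 : Measurable fun w : Sym2 V → ℝ =>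
        (∏ e ∈ G.edgeFinset, w e ^ (B e - 1)) * √(tau G w) * exp (-vw G w x) *
          ∏ i : {v : V // v ≠ x}, vw G w i ^ (-bwt G x B i) := by
      refine Measurable.mul (Measurable.mul (Measurable.mul ?_ (measurable_tau G).sqrt)
        (measurable_vw G x).neg.exp) ?_
      · exact Finset.measurable_prod _ fun e _ => (measurable_pi_apply e).pow_const _
      · exact Finset.measurable_prod _ fun i _ => (measurable_vw G i).pow_const _
    exact (h1.comp (measurable_edgeExt G)).ennreal_ofReal
  have hu : ∀ u ∈ posOrthant (Epin G e0), ∫⁻ r in Set.Ioi (0 : ℝ),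
      ENNReal.ofReal (r ^ Fintype.card (Epin G e0)) * ENNReal.ofReal
        ((∏ e ∈ G.edgeFinset, (r * pinExt G e0 u e) ^ (B e - 1)) *
          √(tau G fun e => r * pinExt G e0 u e) * exp (-vw G (fun e => r * pinExt G e0 u e) x) *
          ∏ i : {v : V // v ≠ x}, vw G (fun e => r * pinExt G e0 u e) i ^ (-bwt G x B i)) =
      ENNReal.ofReal (magicWeight G x B (pinExt G e0 u)) *
        ENNReal.ofReal (Real.Gamma (bwt G x B x)) := by
    intro u hu
    have hw := (pinExt_pos_iff u).2 hu
    have hx := vw_pos hw (hne x)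
    have hm := magicWeight_nonneg hne x B hw
    have hxb := Real.rpow_pos_of_pos hx (bwt G x B x)
    calc _ = ∫⁻ r in Set.Ioi (0 : ℝ), ENNReal.ofReal
          (magicWeight G x B (pinExt G e0 u) * vw G (pinExt G e0 u) x ^ bwt G x B x) *
          ENNReal.ofReal (r ^ (bwt G x B x - 1) * exp (-(vw G (pinExt G e0 u) x * r))) := by
          refine setLIntegral_congr_fun measurableSet_Ioi fun r hr => ?_
          have hr : (0 : ℝ) < r := hr
          rw [← ENNReal.ofReal_mul (by positivity), ← ENNReal.ofReal_mul (by positivity)]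
          congr 1
          refine mul_left_cancel₀ hr.ne' ?_
          rw [mul_left_comm r (_ * _), ← unpinned_smul G hne x B hw hr, ← card_Epin_add_one he0]
          ring
      _ = _ := by
          rw [lintegral_const_mul' _ _ ENNReal.ofReal_ne_top, lintegral_gamma (hb x) hx,
            ← ENNReal.ofReal_mul (by positivity), ← ENNReal.ofReal_mul hm]
          congr 1
          rw [Real.rpow_neg hx.le]
          field_simp
  rw [lintegral_posOrthant_eq_pinned (pinEquiv he0) hmeas] at h
  simp_rw [edgeExt_pinEquiv] at h
  rw [setLIntegral_congr_fun (measurableSet_posOrthant _) hu,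
    lintegral_mul_const' _ _ ENNReal.ofReal_ne_top, mul_assoc, ← ENNReal.ofReal_mul (hΓ x).le,
    ← Fintype.prod_eq_mul_prod_subtype_ne (fun v => Real.Gamma (bwt G x B v)) x,
    ← Znorm_mul_prod_Gamma x B hb] at h
  have hp : 0 < ∏ v, Real.Gamma (bwt G x B v) := Finset.prod_pos fun v _ => hΓ v
  rw [ENNReal.ofReal_mul' hp.le] at h
  exact (ENNReal.mul_left_inj (ENNReal.ofReal_pos.2 hp).ne' ENNReal.ofReal_ne_top).1 h

end Pinning

section EdgeShift
variable {G : SimpleGraph V} [DecidableRel G.Adj]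

lemma prod_mem_eq_sprod (f : V → ℝ) {e : Sym2 V} (he : e ∈ G.edgeFinset) :
    ∏ v, (if v ∈ e then f v else 1) = sprod f e := by
  induction e with
  | _ i j =>
  have hij : i ≠ j := G.ne_of_adj (by simpa using he)
  rw [← Finset.prod_filter, show Finset.univ.filter (· ∈ s(i, j)) = {i, j} by ext; simp,
    Finset.prod_pair hij]
  rfl

lemma sprod_rpow {f : V → ℝ} (hf : ∀ v, 0 < f v) (c : ℝ) (e : Sym2 V) :
    sprod (fun v => f v ^ c) e = sprod f e ^ c := by
  induction e with
  | _ i j => exact (Real.mul_rpow (hf i).le (hf j).le).symm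

variable (a : Sym2 V → ℝ) {e : Sym2 V}

lemma bwt_update (he : e ∈ G.edgeFinset) (x v : V) :
    bwt G x (Function.update a e (a e + 1)) v = bwt G x a v + if v ∈ e then 1 / 2 else 0 := by
  have h : vw G (Function.update a e (a e + 1)) v = vw G a v + if v ∈ e then 1 else 0 := by
    have h1 : ∀ d, (if v ∈ d then Function.update a e (a e + 1) d else 0) =
        (if v ∈ d then a d else 0) + if d = e then (if v ∈ e then 1 else 0) else 0 := by
      intro d
      by_cases hd : d = e
      · subst hd
        rw [Function.update_self, if_pos rfl]
        split_ifs <;> simp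
      · simp [hd]
    rw [vw_eq_sum, vw_eq_sum, Finset.sum_congr rfl fun d _ => h1 d, Finset.sum_add_distrib,
      Finset.sum_ite_eq' G.edgeFinset, if_pos he]
  rw [bwt, bwt, h]
  split_ifs <;> ring

lemma magicWeight_update (hne : ∀ v, (G.neighborFinset v).Nonempty) (he : e ∈ G.edgeFinset) (x : V)
    {w : Sym2 V → ℝ} (hw : ∀ e ∈ G.edgeFinset, 0 < w e) :
    magicWeight G x (Function.update a e (a e + 1)) w =
      magicWeight G x a w * (w e / √(sprod (vw G w) e)) := by
  have hv := fun v => vw_pos hw (hne v)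
  have h1 : ∏ d ∈ G.edgeFinset, w d ^ (Function.update a e (a e + 1) d - 1) =
      (∏ d ∈ G.edgeFinset, w d ^ (a d - 1)) * w e := by
    rw [← Finset.mul_prod_erase _ _ he, ← Finset.mul_prod_erase _ (fun d => w d ^ (a d - 1)) he,
      Function.update_self, add_sub_right_comm, Real.rpow_add_one (hw e he).ne', mul_right_comm]
    congr 2
    refine Finset.prod_congr rfl fun d hd => ?_
    rw [Function.update_of_ne (Finset.ne_of_mem_erase hd)]
  have h2 : ∏ v, vw G w v ^ (-bwt G x (Function.update a e (a e + 1)) v) =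
      (∏ v, vw G w v ^ (-bwt G x a v)) * (√(sprod (vw G w) e))⁻¹ := by
    rw [Real.sqrt_eq_rpow, ← Real.rpow_neg (sprod_pos hv e).le, ← sprod_rpow hv,
      ← prod_mem_eq_sprod _ he, ← Finset.prod_mul_distrib]
    refine Finset.prod_congr rfl fun v _ => ?_
    rw [bwt_update a he, neg_add, Real.rpow_add (hv v)]
    split_ifs <;> simp
  rw [magicWeight, magicWeight, h1, h2]
  ring

lemma Znorm_update (hne : ∀ v, (G.neighborFinset v).Nonempty) (ha : ∀ e ∈ G.edgeFinset, 0 < a e)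
    (he : e ∈ G.edgeFinset) (x : V) :
    Znorm G x (Function.update a e (a e + 1)) = Znorm G x a * (a e / 2 *
      sprod (fun v => Real.Gamma (bwt G x a v) / Real.Gamma (bwt G x a v + 1 / 2)) e) := by
  have hb := fun v => bwt_pos_of_ne x hne ha v
  have hae := ha e he
  have h1 : ∏ d ∈ G.edgeFinset, Real.Gamma (Function.update a e (a e + 1) d) =
      a e * ∏ d ∈ G.edgeFinset, Real.Gamma (a d) := by
    rw [← Finset.mul_prod_erase _ _ he, ← Finset.mul_prod_erase _ (fun d => Real.Gamma (a d)) he,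
      Function.update_self, Real.Gamma_add_one hae.ne', mul_assoc]
    congr 2
    refine Finset.prod_congr rfl fun d hd => ?_
    rw [Function.update_of_ne (Finset.ne_of_mem_erase hd)]
  have h2 : ∑ d ∈ G.edgeFinset, Function.update a e (a e + 1) d =
      ∑ d ∈ G.edgeFinset, a d + 1 := by
    rw [← Finset.add_sum_erase _ _ he, ← Finset.add_sum_erase _ a he, Function.update_self,
      add_right_comm]
    congr 2
    refine Finset.sum_congr rfl fun d hd => ?_
    rw [Function.update_of_ne (Finset.ne_of_mem_erase hd)]
  have h3 : (∏ v, Real.Gamma (bwt G x a v)) = (∏ v, Real.Gamma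
      (bwt G x (Function.update a e (a e + 1)) v)) *
      sprod (fun v => Real.Gamma (bwt G x a v) / Real.Gamma (bwt G x a v + 1 / 2)) e := by
    rw [← prod_mem_eq_sprod _ he, ← Finset.prod_mul_distrib]
    refine Finset.prod_congr rfl fun v _ => ?_
    rw [bwt_update a he]
    split_ifs
    · exact (mul_div_cancel₀ _ (Real.Gamma_pos_of_pos (by linarith [hb v])).ne').symm
    · simp
  have h4 : 0 < ∏ v, Real.Gamma (bwt G x (Function.update a e (a e + 1)) v) := by
    refine Finset.prod_pos fun v _ => Real.Gamma_pos_of_pos ?_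
    rw [bwt_update a he]
    have := hb v
    split_ifs <;> linarith
  have h5 : 0 < sprod (fun v => Real.Gamma (bwt G x a v) / Real.Gamma (bwt G x a v + 1 / 2)) e :=
    sprod_pos (fun v => div_pos (Real.Gamma_pos_of_pos (hb v))
      (Real.Gamma_pos_of_pos (by linarith [hb v]))) e
  revert h3 h5
  generalize sprod (fun v => Real.Gamma (bwt G x a v) / Real.Gamma (bwt G x a v + 1 / 2)) e = S
  intro h3 h5
  rw [Znorm, Znorm, h1, h2, h3, ← add_assoc, Real.rpow_add_one two_ne_zero]
  field_simp

lemma Znorm_pos (hne : ∀ v, (G.neighborFinset v).Nonempty) (ha : ∀ e ∈ G.edgeFinset, 0 < a e)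
    (x : V) : 0 < Znorm G x a := by
  have h1 : 0 < ∏ e ∈ G.edgeFinset, Real.Gamma (a e) :=
    Finset.prod_pos fun e he => Real.Gamma_pos_of_pos (ha e he)
  have h2 : 0 < ∏ v, Real.Gamma (bwt G x a v) :=
    Finset.prod_pos fun v _ => Real.Gamma_pos_of_pos (bwt_pos_of_ne x hne ha v)
  unfold Znorm
  positivity

lemma neighborFinset_nonempty (hG : G.Connected) (he : e ∈ G.edgeFinset) (v : V) :
    (G.neighborFinset v).Nonempty := by
  induction e with
  | _ i j =>
  have hij : G.Adj i j := by simpa using he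
  have : Nontrivial V := ⟨i, j, hij.ne⟩
  obtain ⟨u, hu⟩ := hG.preconnected.exists_adj_of_nontrivial v
  exact ⟨u, by simpa using hu⟩

lemma measurable_sprod_vw (e : Sym2 V) : Measurable fun w : Sym2 V → ℝ => sprod (vw G w) e := by
  induction e with
  | _ i j => exact (measurable_vw G i).mul (measurable_vw G j)

end EdgeShift

/-- For every edge `e = {i,j} ∈ E`,
`∫ w_e/√(w_i w_j) dμ_{v0,A}(w) = (a_e/2)·Γ(b_i)/Γ(b_i+1/2)·Γ(b_j)/Γ(b_j+1/2)`. -/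
theorem mean_of_Ye
    {V : Type*} [Fintype V] [DecidableEq V]
    (G : SimpleGraph V) [DecidableRel G.Adj] (hG : G.Connected)
    (v0 : V) (e0 : Sym2 V) (he0 : e0 ∈ G.edgeFinset)
    (a : Sym2 V → ℝ) (ha : ∀ e ∈ G.edgeFinset, 0 < a e)
    (e : Sym2 V) (he : e ∈ G.edgeFinset) :
    ∫ w, w e / Real.sqrt (sprod (vw G w) e) ∂(mixing G e0 v0 a)
      = a e / 2 *
        sprod (fun v => Real.Gamma (bwt G v0 a v) / Real.Gamma (bwt G v0 a v + 1 / 2)) e := by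
  have hne := neighborFinset_nonempty hG he
  have hZ := Znorm_pos a hne ha v0
  have hmeas : Measurable fun w : Sym2 V → ℝ => w e / √(sprod (vw G w) e) :=
    (measurable_pi_apply e).div (measurable_sprod_vw e).sqrt
  have hP := measurableSet_posOrthant (Epin G e0)
  have hdens : (fun u : Epin G e0 → ℝ => ENNReal.ofReal
      (if ∀ e ∈ G.edgeFinset, 0 < pinExt G e0 u e then
        magicDensity G v0 a (pinExt G e0 u) else 0)) = (posOrthant (Epin G e0)).indicator
      fun u => ENNReal.ofReal ((Znorm G v0 a)⁻¹ * magicWeight G v0 a (pinExt G e0 u)) := by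
    ext u
    by_cases hu : u ∈ posOrthant (Epin G e0)
    · have hw := (pinExt_pos_iff u).2 hu
      rw [Set.indicator_of_mem hu, if_pos hw, magicDensity_eq G hne v0 a hw]
    · rw [Set.indicator_of_notMem hu, if_neg ((pinExt_pos_iff u).not.2 hu), ENNReal.ofReal_zero]
  have hm : ∀ B, Measurable fun u => magicWeight G v0 B (pinExt G e0 u) :=
    fun B => (measurable_magicWeight v0 B).comp measurable_pinExt
  have ha' : ∀ d ∈ G.edgeFinset, 0 < Function.update a e (a e + 1) d := by
    intro d hd
    have := ha d hd
    by_cases h : d = e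
    · subst h
      rw [Function.update_self]
      linarith
    · rwa [Function.update_of_ne h]
  have hI : ∫ u in posOrthant (Epin G e0), magicWeight G v0 (Function.update a e (a e + 1))
      (pinExt G e0 u) = Znorm G v0 (Function.update a e (a e + 1)) := by
    rw [integral_eq_lintegral_of_nonneg_ae _ (hm _).aestronglyMeasurable,
      lintegral_magicWeight hG hne he0 v0 ha', ENNReal.toReal_ofReal (Znorm_pos _ hne ha' v0).le]
    exact (ae_restrict_iff' hP).2 (Eventually.of_forall fun u hu =>
      magicWeight_nonneg hne v0 _ ((pinExt_pos_iff u).2 hu))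
  rw [mixing, integral_map measurable_pinExt.aemeasurable hmeas.aestronglyMeasurable, hdens,
    withDensity_indicator hP, integral_withDensity_eq_integral_toReal_smul
      ((hm a).const_mul _).ennreal_ofReal (Eventually.of_forall fun _ => ENNReal.ofReal_lt_top)]
  calc _ = ∫ u in posOrthant (Epin G e0), (Znorm G v0 a)⁻¹ *
        magicWeight G v0 (Function.update a e (a e + 1)) (pinExt G e0 u) := by
        refine setIntegral_congr_fun hP fun u hu => ?_
        have hw := (pinExt_pos_iff u).2 hu
        have := magicWeight_nonneg hne v0 a hw
        simp only [smul_eq_mul]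
        rw [ENNReal.toReal_ofReal (by positivity), magicWeight_update a hne he v0 hw, mul_assoc]
    _ = _ := by
        rw [integral_const_mul, hI, Znorm_update a hne ha he v0, inv_mul_cancel_left₀ hZ.ne']

end ERRW
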